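/- arXiv:1610.04353 — 3 statements merged into one kernel-verified Lean document; each statement's English description precedes it below -/
import Mathlib

section
/- Let h_1,…,h_n ∈ ℤ_{≥0} with H = h_1+⋯+h_n, and set D₀ = max_{1≤i≤n}(h_i+1)(H−h_i). Then (y_1^{(h_1)}·y_2^{(h_2)}⋯y_n^{(h_n)})^{D₀} ∉ I_H. Consequently, the minimal d such that (y_1^{(h_1)}⋯y_n^{(h_n)})^d ∈ I_H equals max_{1≤i≤n}(h_i+1)(H−h_i) + 1. -/
open MvPolynomial

section Regular

variable {A : Type*} [CommRing A]

/-- The coefficients of the product of the shifted series `∑ x (σ + j) t ^ j` and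
`∑ W (k + j) t ^ j`. -/
def shiftedConv (x W : ℕ → A) (σ k l : ℕ) : A :=
  ∑ p ∈ Finset.HasAntidiagonal.antidiagonal l, x (σ + p.1) * W (k + p.2)

lemma shiftedConv_zero (x W : ℕ → A) (σ k : ℕ) : shiftedConv x W σ k 0 = x σ * W k := by
  simp [shiftedConv]

lemma shiftedConv_succ (x W : ℕ → A) (σ k l : ℕ) :
    shiftedConv x W σ k (l + 1) = x σ * W (k + l + 1) + shiftedConv x W (σ + 1) k l := by
  simp only [shiftedConv, Finset.Nat.sum_antidiagonal_succ, add_zero]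
  congr 1
  exact Finset.sum_congr rfl fun p _ => by rw [add_right_comm σ 1, add_assoc σ]

lemma shiftedConv_succ' (x W : ℕ → A) (σ k l : ℕ) :
    shiftedConv x W σ k (l + 1) = x (σ + l + 1) * W k + shiftedConv x W σ (k + 1) l := by
  simp only [shiftedConv, Finset.Nat.sum_antidiagonal_succ', add_zero]
  rw [← add_assoc]
  congr 1
  exact Finset.sum_congr rfl fun p _ => by rw [add_right_comm k 1, add_assoc k]

/-- The ideal generated by `L`, the first `σ` terms of `x`, the first `k` terms of `W` and the first
`m` coefficients of the product of the correspondingly shifted series. -/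
def mixedIdeal (L : Ideal A) (x W : ℕ → A) (σ k m : ℕ) : Ideal A :=
  L ⊔ Ideal.span (x '' Set.Iio σ) ⊔ Ideal.span (W '' Set.Iio k) ⊔
    Ideal.span (shiftedConv x W σ k '' Set.Iio m)

variable {L : Ideal A} {x W : ℕ → A} {σ k m : ℕ}

lemma le_mixedIdeal : L ≤ mixedIdeal L x W σ k m :=
  le_sup_left.trans (le_sup_left.trans le_sup_left)

lemma left_mem_mixedIdeal {j : ℕ} (hj : j < σ) : x j ∈ mixedIdeal L x W σ k m :=
  (le_sup_right.trans (le_sup_left.trans le_sup_left) :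
    Ideal.span (x '' Set.Iio σ) ≤ _) (Ideal.subset_span ⟨j, hj, rfl⟩)

lemma right_mem_mixedIdeal {j : ℕ} (hj : j < k) : W j ∈ mixedIdeal L x W σ k m :=
  (le_sup_right.trans le_sup_left : Ideal.span (W '' Set.Iio k) ≤ _)
    (Ideal.subset_span ⟨j, hj, rfl⟩)

lemma shiftedConv_mem_mixedIdeal {j : ℕ} (hj : j < m) :
    shiftedConv x W σ k j ∈ mixedIdeal L x W σ k m :=
  (le_sup_right : Ideal.span (shiftedConv x W σ k '' Set.Iio m) ≤ _)
    (Ideal.subset_span ⟨j, hj, rfl⟩)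

lemma mixedIdeal_le {J : Ideal A} (hL : L ≤ J) (hx : ∀ j < σ, x j ∈ J) (hW : ∀ j < k, W j ∈ J)
    (hC : ∀ j < m, shiftedConv x W σ k j ∈ J) : mixedIdeal L x W σ k m ≤ J := by
  refine sup_le (sup_le (sup_le hL ?_) ?_) ?_ <;> rw [Ideal.span_le] <;> rintro _ ⟨j, hj, rfl⟩
  exacts [hx j hj, hW j hj, hC j hj]

lemma mixedIdeal_mono {m' : ℕ} (h : m ≤ m') : mixedIdeal L x W σ k m ≤ mixedIdeal L x W σ k m' :=
  mixedIdeal_le le_mixedIdeal (fun _ => left_mem_mixedIdeal) (fun _ => right_mem_mixedIdeal)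
    fun _ hj => shiftedConv_mem_mixedIdeal (hj.trans_le h)

lemma mixedIdeal_succ_le_left : mixedIdeal L x W σ k (m + 1) ≤ mixedIdeal L x W (σ + 1) k m := by
  refine mixedIdeal_le le_mixedIdeal (fun _ hj => left_mem_mixedIdeal (hj.trans σ.lt_succ_self))
    (fun _ => right_mem_mixedIdeal) fun j hj => ?_
  have hxσ : x σ ∈ mixedIdeal L x W (σ + 1) k m := left_mem_mixedIdeal σ.lt_succ_self
  cases j with
  | zero => rw [shiftedConv_zero]; exact Ideal.mul_mem_right _ _ hxσ
  | succ j =>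
    rw [shiftedConv_succ]
    exact add_mem (Ideal.mul_mem_right _ _ hxσ) (shiftedConv_mem_mixedIdeal (by omega))

lemma mixedIdeal_le_succ_sup :
    mixedIdeal L x W (σ + 1) k m ≤ mixedIdeal L x W σ k (m + 1) ⊔ Ideal.span {x σ} := by
  have hxσ : x σ ∈ mixedIdeal L x W σ k (m + 1) ⊔ Ideal.span {x σ} :=
    Ideal.mem_sup_right (Ideal.mem_span_singleton_self _)
  refine mixedIdeal_le (le_mixedIdeal.trans le_sup_left) (fun j hj => ?_)
    (fun j hj => Ideal.mem_sup_left (right_mem_mixedIdeal hj)) fun j hj => ?_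
  · rcases Nat.lt_succ_iff_lt_or_eq.1 hj with hj | rfl
    · exact Ideal.mem_sup_left (left_mem_mixedIdeal hj)
    · exact hxσ
  · have h := shiftedConv_succ x W σ k j
    rw [← sub_eq_iff_eq_add'] at h
    rw [← h]
    exact sub_mem (Ideal.mem_sup_left (shiftedConv_mem_mixedIdeal (by omega)))
      (Ideal.mul_mem_right _ _ hxσ)

lemma mul_mem_mixedIdeal_succ {g : A} (hg : g ∈ mixedIdeal L x W σ (k + 1) m) :
    x σ * g ∈ mixedIdeal L x W σ k (m + 1) := by
  have hC0 : x σ * W k ∈ mixedIdeal L x W σ k (m + 1) := by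
    rw [← shiftedConv_zero]; exact shiftedConv_mem_mixedIdeal m.succ_pos
  suffices h : mixedIdeal L x W σ (k + 1) m ≤
      Submodule.comap (LinearMap.mulLeft A (x σ)) (mixedIdeal L x W σ k (m + 1)) from h hg
  refine mixedIdeal_le (fun a ha => ?_) (fun j hj => ?_) (fun j hj => ?_) fun j hj => ?_ <;>
    simp only [Submodule.mem_comap, LinearMap.mulLeft_apply]
  · exact Ideal.mul_mem_left _ _ (le_mixedIdeal ha)
  · exact Ideal.mul_mem_left _ _ (left_mem_mixedIdeal hj)
  · rcases Nat.lt_succ_iff_lt_or_eq.1 hj with hj | rfl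
    · exact Ideal.mul_mem_left _ _ (right_mem_mixedIdeal hj)
    · exact hC0
  · have h := shiftedConv_succ' x W σ k j
    rw [← sub_eq_iff_eq_add'] at h
    rw [← h, mul_sub, mul_left_comm]
    exact sub_mem (Ideal.mul_mem_left _ _ (shiftedConv_mem_mixedIdeal (by omega)))
      (Ideal.mul_mem_left _ _ hC0)

lemma shiftedConv_mem_mixedIdeal_right :
    shiftedConv x W σ k m ∈ mixedIdeal L x W σ (k + 1) m := by
  have hW : W k ∈ mixedIdeal L x W σ (k + 1) m := right_mem_mixedIdeal k.lt_succ_self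
  cases m with
  | zero => rw [shiftedConv_zero]; exact Ideal.mul_mem_left _ _ hW
  | succ m =>
    rw [shiftedConv_succ']
    exact add_mem (Ideal.mul_mem_left _ _ hW) (shiftedConv_mem_mixedIdeal m.lt_succ_self)

lemma mem_mixedIdeal_succ {y : A} (h : y ∈ mixedIdeal L x W σ k (m + 1)) :
    ∃ r, y - shiftedConv x W σ k m * r ∈ mixedIdeal L x W σ k m := by
  have : mixedIdeal L x W σ k (m + 1) ≤
      mixedIdeal L x W σ k m ⊔ Ideal.span {shiftedConv x W σ k m} := by
    refine mixedIdeal_le (le_mixedIdeal.trans le_sup_left)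
      (fun j hj => Ideal.mem_sup_left (left_mem_mixedIdeal hj))
      (fun j hj => Ideal.mem_sup_left (right_mem_mixedIdeal hj)) fun j hj => ?_
    rcases Nat.lt_succ_iff_lt_or_eq.1 hj with hj | rfl
    · exact Ideal.mem_sup_left (shiftedConv_mem_mixedIdeal hj)
    · exact Ideal.mem_sup_right (Ideal.mem_span_singleton_self _)
  obtain ⟨e, he, z, hz, rfl⟩ := Submodule.mem_sup.1 (this h)
  obtain ⟨r, rfl⟩ := Ideal.mem_span_singleton'.1 hz
  exact ⟨r, by simpa [mul_comm r] using he⟩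

lemma exists_sub_mul_mem_mixedIdeal {y : A} (h : y ∈ mixedIdeal L x W (σ + 1) k m) :
    ∃ r, y - x σ * r ∈ mixedIdeal L x W σ k (m + 1) := by
  obtain ⟨e, he, z, hz, rfl⟩ := Submodule.mem_sup.1 (mixedIdeal_le_succ_sup h)
  obtain ⟨r, rfl⟩ := Ideal.mem_span_singleton'.1 hz
  exact ⟨r, by simpa [mul_comm r] using he⟩

lemma shiftedConv_notMem {P : Ideal A} [P.IsPrime] {i j : ℕ} (hx : ∀ l < σ + i, x l ∈ P)
    (hxP : x (σ + i) ∉ P) (hW : ∀ l < k + j, W l ∈ P) (hWP : W (k + j) ∉ P) :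
    shiftedConv x W σ k (i + j) ∉ P := by
  have hmem : (i, j) ∈ Finset.HasAntidiagonal.antidiagonal (i + j) := by simp
  rw [shiftedConv, ← Finset.add_sum_erase _ _ hmem]
  intro h
  refine (Ideal.IsPrime.mem_or_mem ‹_› ((Ideal.add_mem_iff_left _ ?_).1 h)).elim hxP hWP
  refine sum_mem fun p hp => ?_
  obtain ⟨hne, hp⟩ := Finset.mem_erase.1 hp
  rw [Finset.HasAntidiagonal.mem_antidiagonal] at hp
  rcases lt_trichotomy p.1 i with h | h | h
  · exact Ideal.mul_mem_right _ _ (hx _ (by omega))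
  · exact absurd (Prod.ext h (by dsimp only; omega)) hne
  · exact Ideal.mul_mem_left _ _ (hW _ (by omega))

/-- If the zero divisors modulo `(L, x_{<σ}, W_{<k})` lie in the union of the primes in `𝒬 σ k`,
then the zero divisors modulo `mixedIdeal L x W σ k m` lie in the union of the primes in
`𝒬 (σ + i) (k + j)`, where `i + j = m`. -/
theorem mem_mixedIdeal_of_mul_mem (𝒬 : ℕ → ℕ → Set (Ideal A))
    (hprime : ∀ σ k, ∀ P ∈ 𝒬 σ k, P.IsPrime)
    (hx : ∀ σ k, ∀ P ∈ 𝒬 σ k, ∀ j < σ, x j ∈ P) (hx' : ∀ σ k, ∀ P ∈ 𝒬 σ k, x σ ∉ P)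
    (hW : ∀ σ k, ∀ P ∈ 𝒬 σ k, ∀ j < k, W j ∈ P) (hW' : ∀ σ k, ∀ P ∈ 𝒬 σ k, W k ∉ P)
    (hbase : ∀ σ k u, (∀ P ∈ 𝒬 σ k, u ∉ P) →
      ∀ g, u * g ∈ mixedIdeal L x W σ k 0 → g ∈ mixedIdeal L x W σ k 0) (m : ℕ) :
    ∀ σ k u, (∀ i j, i + j = m → ∀ P ∈ 𝒬 (σ + i) (k + j), u ∉ P) →
      ∀ g, u * g ∈ mixedIdeal L x W σ k m → g ∈ mixedIdeal L x W σ k m := by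
  suffices H : (∀ σ k u, (∀ i j, i + j = m → ∀ P ∈ 𝒬 (σ + i) (k + j), u ∉ P) →
      ∀ g, u * g ∈ mixedIdeal L x W σ k m → g ∈ mixedIdeal L x W σ k m) ∧
      ∀ σ k g, x σ * g ∈ mixedIdeal L x W σ k (m + 1) → g ∈ mixedIdeal L x W σ (k + 1) m from H.1
  induction m with
  | zero =>
    refine ⟨fun σ k u hu => hbase σ k u (hu 0 0 rfl), fun σ k g hg => ?_⟩
    obtain ⟨r, hr⟩ := mem_mixedIdeal_succ hg
    rw [shiftedConv_zero, mul_assoc, ← mul_sub] at hr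
    have h := hbase σ k _ (hx' σ k) _ hr
    have h' : mixedIdeal L x W σ k 0 ≤ mixedIdeal L x W σ (k + 1) 0 :=
      mixedIdeal_le le_mixedIdeal (fun _ => left_mem_mixedIdeal)
        (fun _ hj => right_mem_mixedIdeal (hj.trans k.lt_succ_self)) (by simp)
    simpa using add_mem (h' h)
      (Ideal.mul_mem_right r _ (right_mem_mixedIdeal (L := L) (x := x) (W := W) (σ := σ) (m := 0)
        k.lt_succ_self))
  | succ m ih =>
    obtain ⟨ih₁, ih₂⟩ := ih
    refine ⟨fun σ k u hu g hg => ?_, fun σ k g hg => ?_⟩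
    · have h₁ := ih₁ (σ + 1) k u
        (fun i j hij => by rw [add_assoc, add_comm 1]; exact hu (i + 1) j (by omega)) g
        (mixedIdeal_succ_le_left hg)
      obtain ⟨g₁, hg₁⟩ := exists_sub_mul_mem_mixedIdeal h₁
      have h₂ : x σ * (u * g₁) ∈ mixedIdeal L x W σ k (m + 1) := by
        have := sub_mem hg (Ideal.mul_mem_left _ u hg₁)
        rwa [mul_sub, sub_sub_cancel, mul_left_comm] at this
      have h₃ := ih₁ σ (k + 1) u
        (fun i j hij => by rw [add_assoc, add_comm 1]; exact hu i (j + 1) (by omega)) g₁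
        (ih₂ σ k _ h₂)
      simpa using add_mem hg₁ (mul_mem_mixedIdeal_succ h₃)
    · obtain ⟨r, hr⟩ := mem_mixedIdeal_succ hg
      have h₁ : shiftedConv x W (σ + 1) k m * r ∈ mixedIdeal L x W (σ + 1) k m := by
        have hxσ : x σ ∈ mixedIdeal L x W (σ + 1) k m := left_mem_mixedIdeal σ.lt_succ_self
        have := sub_mem (Ideal.mul_mem_right g _ hxσ) (mixedIdeal_succ_le_left hr)
        rw [sub_sub_cancel, shiftedConv_succ, add_mul, mul_assoc] at this
        exact (Ideal.add_mem_iff_right _ (Ideal.mul_mem_right _ _ hxσ)).1 this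
      have h₂ := ih₁ (σ + 1) k _ (fun i j hij P hP => by
        have := hprime _ _ P hP
        subst hij
        exact shiftedConv_notMem (hx _ _ P hP) (hx' _ _ P hP) (hW _ _ P hP) (hW' _ _ P hP)) r h₁
      obtain ⟨e, he⟩ := exists_sub_mul_mem_mixedIdeal h₂
      have h₃ : x σ * (g - shiftedConv x W σ k (m + 1) * e) ∈ mixedIdeal L x W σ k (m + 1) := by
        have := add_mem hr (Ideal.mul_mem_left _ (shiftedConv x W σ k (m + 1)) he)
        convert this using 1
        ring
      have h₄ := mixedIdeal_mono m.le_succ (ih₂ σ k _ h₃)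
      simpa using add_mem h₄
        (Ideal.mul_mem_right e _ (shiftedConv_mem_mixedIdeal_right (L := L) (x := x) (W := W)
          (σ := σ) (k := k) (m := m + 1)))

end Regular

section Jets

lemma shiftedConv_eq_coeff_mul {A : Type*} [CommRing A] (f g : PowerSeries A) (l : ℕ) :
    shiftedConv (fun j => PowerSeries.coeff j f) (fun j => PowerSeries.coeff j g) 0 0 l =
      PowerSeries.coeff l (f * g) := by
  simp [shiftedConv, PowerSeries.coeff_mul]

lemma coeff_prod_mem {A ι : Type*} [CommRing A] (P : Ideal A) (f : ι → PowerSeries A) (a : ι → ℕ)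
    (S : Finset ι) (h : ∀ i ∈ S, ∀ j < a i, PowerSeries.coeff j (f i) ∈ P) :
    ∀ j < ∑ i ∈ S, a i, PowerSeries.coeff j (∏ i ∈ S, f i) ∈ P := by
  classical
  induction S using Finset.induction_on with
  | empty => simp
  | insert i S hi ih =>
    intro j hj
    rw [Finset.sum_insert hi] at hj
    rw [Finset.prod_insert hi, PowerSeries.coeff_mul]
    refine sum_mem fun p hp => ?_
    rw [Finset.HasAntidiagonal.mem_antidiagonal] at hp
    by_cases hpi : p.1 < a i
    · exact Ideal.mul_mem_right _ _ (h i (Finset.mem_insert_self _ _) _ hpi)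
    · exact Ideal.mul_mem_left _ _
        (ih (fun i' hi' => h i' (Finset.mem_insert_of_mem hi')) _ (by omega))

lemma coeff_prod_notMem {A ι : Type*} [CommRing A] (P : Ideal A) [P.IsPrime]
    (f : ι → PowerSeries A) (a : ι → ℕ) (S : Finset ι)
    (h : ∀ i ∈ S, ∀ j < a i, PowerSeries.coeff j (f i) ∈ P)
    (h' : ∀ i ∈ S, PowerSeries.coeff (a i) (f i) ∉ P) :
    PowerSeries.coeff (∑ i ∈ S, a i) (∏ i ∈ S, f i) ∉ P := by
  classical
  induction S using Finset.induction_on with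
  | empty => simpa using (Ideal.ne_top_iff_one P).1 (Ideal.IsPrime.ne_top ‹_›)
  | insert i S hi ih =>
    rw [Finset.sum_insert hi, Finset.prod_insert hi, ← shiftedConv_eq_coeff_mul]
    have hS : ∀ i ∈ S, ∀ j < a i, PowerSeries.coeff j (f i) ∈ P :=
      fun i' hi' => h i' (Finset.mem_insert_of_mem hi')
    refine shiftedConv_notMem (fun l hl => ?_) ?_ (fun l hl => ?_) ?_
    · exact h i (Finset.mem_insert_self _ _) l (by omega)
    · simpa using h' i (Finset.mem_insert_self _ _)
    · exact coeff_prod_mem P f a S hS l (by omega)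
    · simpa using ih hS fun i' hi' => h' i' (Finset.mem_insert_of_mem hi')

variable {K : Type*} [Field K] {v ι : Type*}

/-- The ideal generated by a set of variables. -/
noncomputable def variableIdeal (K : Type*) [Field K] {v : Type*} (T : Set v) :
    Ideal (MvPolynomial v K) :=
  Ideal.span (X '' T)

lemma X_mem_variableIdeal {T : Set v} {z : v} :
    (X z : MvPolynomial v K) ∈ variableIdeal K T ↔ z ∈ T := by
  classical
  rw [variableIdeal, mem_ideal_span_X_image]
  simp [support_X, Finsupp.single_apply]

lemma variableIdeal_isPrime (T : Set v) : (variableIdeal K T).IsPrime := by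
  classical
  let φ : MvPolynomial v K →ₐ[K] MvPolynomial v K := aeval fun z => if z ∈ T then 0 else X z
  have hφ : ∀ g, g - φ g ∈ variableIdeal K T := by
    intro g
    rw [← Ideal.Quotient.eq]
    have : (Ideal.Quotient.mkₐ K (variableIdeal K T)) =
        (Ideal.Quotient.mkₐ K (variableIdeal K T)).comp φ := by
      ext z
      by_cases hz : z ∈ T
      · simpa [φ, hz, Ideal.Quotient.eq_zero_iff_mem] using X_mem_variableIdeal.2 hz
      · simp [φ, hz]
    exact DFunLike.congr_fun this g
  have : variableIdeal K T = RingHom.ker φ := by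
    refine le_antisymm ?_ fun g hg => ?_
    · rw [variableIdeal, Ideal.span_le]
      rintro _ ⟨z, hz, rfl⟩
      simp [φ, hz]
    · simpa [(RingHom.mem_ker).1 hg] using hφ g
  rw [this]
  exact RingHom.ker_isPrime φ

/-- The generic power series `∑ X (i, j) t ^ j`. -/
noncomputable def genericSeries (K : Type*) [Field K] {ι : Type*} (i : ι) :
    PowerSeries (MvPolynomial (ι × ℕ) K) :=
  PowerSeries.mk fun j => X (i, j)

/-- The ideal of the variables `X (i, j)` with `j < a i`. -/
noncomputable def staircaseIdeal (K : Type*) [Field K] {ι : Type*} (a : ι → ℕ) :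
    Ideal (MvPolynomial (ι × ℕ) K) :=
  variableIdeal K {z | z.2 < a z.1}

/-- The ideal generated by the coefficients of `t ^ k`, `k < N`, in the product of the generic
power series. -/
noncomputable def jetIdeal (K : Type*) [Field K] (ι : Type*) [Fintype ι] (N : ℕ) :
    Ideal (MvPolynomial (ι × ℕ) K) :=
  Ideal.span ((fun k => PowerSeries.coeff k (∏ i, genericSeries K i)) '' Set.Iio N)

theorem mem_sup_of_mul_mem_of_notMem (S : Finset ι) :
    ∀ (k : ℕ) (Z : Set (ι × ℕ)) (_ : ∀ z ∈ Z, z.1 ∉ S) (u : MvPolynomial (ι × ℕ) K)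
      (_ : ∀ a : ι → ℕ, ∑ i ∈ S, a i = k →
        u ∉ variableIdeal K (Z ∪ {z | z.1 ∈ S ∧ z.2 < a z.1})) (g : MvPolynomial (ι × ℕ) K),
      u * g ∈ variableIdeal K Z ⊔
        Ideal.span ((fun k => PowerSeries.coeff k (∏ i ∈ S, genericSeries K i)) '' Set.Iio k) →
      g ∈ variableIdeal K Z ⊔
        Ideal.span ((fun k => PowerSeries.coeff k (∏ i ∈ S, genericSeries K i)) '' Set.Iio k) := by
  classical
  induction S using Finset.induction_on with
  | empty =>
    intro k Z _ u hu g hg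
    rcases Nat.eq_zero_or_pos k with rfl | hk
    · have := variableIdeal_isPrime (K := K) Z
      simp only [Finset.notMem_empty, false_and, Set.ofPred_false, Set.union_empty,
        Finset.sum_empty, forall_const] at hu
      simp only [Set.image_empty, Ideal.span_empty, sup_bot_eq, Set.Iio_eq_empty_iff.2 isMin_bot,
        ← bot_eq_zero] at hg ⊢
      exact (Ideal.IsPrime.mem_or_mem this hg).resolve_left hu
    · have : (1 : MvPolynomial (ι × ℕ) K) ∈ Ideal.span ((fun k => PowerSeries.coeff k
          (∏ i ∈ (∅ : Finset ι), genericSeries K i)) '' Set.Iio k) :=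
        Ideal.subset_span ⟨0, hk, by simp⟩
      rw [(Ideal.eq_top_iff_one _).2 this]
      simp
  | insert i S hi ih =>
    intro m Z hZ u hu g
    let x : ℕ → MvPolynomial (ι × ℕ) K := fun j => X (i, j)
    let W : ℕ → MvPolynomial (ι × ℕ) K :=
      fun k => PowerSeries.coeff k (∏ i ∈ S, genericSeries K i)
    let T : ℕ → Set (ι × ℕ) := fun σ => Z ∪ {z | z.1 = i ∧ z.2 < σ}
    let Q : (σ : ℕ) → (ι → ℕ) → Ideal (MvPolynomial (ι × ℕ) K) :=
      fun σ a => variableIdeal K (T σ ∪ {z | z.1 ∈ S ∧ z.2 < a z.1})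
    have hQ : ∀ σ a, (Q σ a).IsPrime := fun σ a => variableIdeal_isPrime _
    have hZS : ∀ z ∈ Z, z.1 ≠ i ∧ z.1 ∉ S := fun z hz => by simpa using hZ z hz
    have hQS : ∀ σ a, ∀ i' ∈ S, ∀ j,
        PowerSeries.coeff j (genericSeries K i') ∈ Q σ a ↔ j < a i' := by
      intro σ a i' hi' j
      have h₁ : i' ≠ i := fun h => hi (h ▸ hi')
      have h₂ : (i', j) ∉ Z := fun h => (hZS _ h).2 hi'
      simp [genericSeries, Q, T, X_mem_variableIdeal, hi', h₁, h₂]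
    have hmix : ∀ σ k, mixedIdeal (variableIdeal K Z) x W σ k 0 =
        variableIdeal K (T σ) ⊔ Ideal.span (W '' Set.Iio k) := by
      intro σ k
      have : x '' Set.Iio σ = X '' {z : ι × ℕ | z.1 = i ∧ z.2 < σ} := by
        ext y
        constructor
        · rintro ⟨j, hj, rfl⟩
          exact ⟨(i, j), ⟨rfl, hj⟩, rfl⟩
        · rintro ⟨⟨_, j⟩, ⟨rfl, hj⟩, rfl⟩
          exact ⟨j, hj, rfl⟩
      simp only [mixedIdeal, this, variableIdeal, T, Set.image_union, Ideal.span_union]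
      simp
    have key := mem_mixedIdeal_of_mul_mem (L := variableIdeal K Z) (x := x) (W := W)
      (fun σ k => {P | ∃ a : ι → ℕ, ∑ i ∈ S, a i = k ∧ P = Q σ a})
      (by rintro σ k _ ⟨a, -, rfl⟩; exact hQ σ a)
      (by
        rintro σ k _ ⟨a, -, rfl⟩ j hj
        exact X_mem_variableIdeal.2 (Or.inl (Or.inr ⟨rfl, hj⟩)))
      (by
        rintro σ k _ ⟨a, -, rfl⟩ h
        rcases X_mem_variableIdeal.1 h with (h | h) | h
        · exact (hZS _ h).1 rfl
        · exact lt_irrefl _ h.2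
        · exact hi h.1)
      (by
        rintro σ k _ ⟨a, rfl, rfl⟩
        exact coeff_prod_mem _ _ a S fun i' hi' j => (hQS σ a i' hi' j).2)
      (by
        rintro σ k _ ⟨a, rfl, rfl⟩
        have := hQ σ a
        exact coeff_prod_notMem _ _ a S (fun i' hi' j => (hQS σ a i' hi' j).2)
          fun i' hi' => by simp [hQS σ a i' hi'])
      (by
        intro σ k u hu g hg
        rw [hmix] at hg ⊢
        refine ih k (T σ) ?_ u (fun a ha => hu _ ⟨a, ha, rfl⟩) g hg
        rintro z (hz | ⟨hz, -⟩)
        · exact (hZS z hz).2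
        · exact hz ▸ hi)
      m 0 0 u
      (by
        rintro p q hpq _ ⟨a, ha, rfl⟩
        have := hu (Function.update a i p) (by
          rw [Finset.sum_insert hi, Function.update_self, Finset.sum_update_of_notMem hi, ha]
          omega)
        convert this using 3
        ext ⟨i', j⟩
        rcases eq_or_ne i' i with rfl | h
        · simp [T, hi]
        · simp [T, h])
      g
    have hmix' : mixedIdeal (variableIdeal K Z) x W 0 0 m = variableIdeal K Z ⊔ Ideal.span
        ((fun k => PowerSeries.coeff k (∏ i ∈ insert i S, genericSeries K i)) '' Set.Iio m) := by
      have : shiftedConv x W 0 0 =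
          fun k => PowerSeries.coeff k (∏ i ∈ insert i S, genericSeries K i) := by
        ext1 l
        rw [Finset.prod_insert hi, ← shiftedConv_eq_coeff_mul]
        simp [x, W, genericSeries]
      simp [mixedIdeal, this]
    rwa [hmix'] at key

/-- Zero divisors modulo `jetIdeal K ι N` lie in one of the ideals `staircaseIdeal K a` with
`∑ i, a i = N`. -/
theorem mem_jetIdeal_of_mul_mem [Fintype ι] {N : ℕ} {u g : MvPolynomial (ι × ℕ) K}
    (hu : ∀ a : ι → ℕ, ∑ i, a i = N → u ∉ staircaseIdeal K a) (h : u * g ∈ jetIdeal K ι N) :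
    g ∈ jetIdeal K ι N := by
  have := mem_sup_of_mul_mem_of_notMem (K := K) (Finset.univ : Finset ι) N ∅ (by simp) u
    (by simpa [staircaseIdeal] using hu) g
  simpa [variableIdeal, jetIdeal] using this (by simpa [variableIdeal, jetIdeal] using h)

/-- To show that a polynomial lies in `jetIdeal K ι N`, one may invert `∏ i, X (i, a i)` for
each `a` with `∑ i, a i = N` separately. -/
theorem mem_jetIdeal_of_forall_prod_pow_mul_mem [Fintype ι] {N : ℕ}
    {g : MvPolynomial (ι × ℕ) K} (h : ∀ a : ι → ℕ, ∑ i, a i = N →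
      ∃ s : ℕ, (∏ i, X (i, a i)) ^ s * g ∈ jetIdeal K ι N) : g ∈ jetIdeal K ι N := by
  classical
  choose! s hs using h
  let F : Finset (ι → ℕ) := Finset.piAntidiag Finset.univ N
  have hF : ∀ a, a ∈ F ↔ ∑ i, a i = N := by simp [F]
  refine mem_jetIdeal_of_mul_mem
    (u := ∑ a ∈ F, (∏ i, X (i, a i)) ^ (s a + 1)) (fun a ha hmem => ?_) ?_
  · have hprime := variableIdeal_isPrime (K := K) {z : ι × ℕ | z.2 < a z.1}
    rw [← Finset.add_sum_erase _ _ ((hF a).2 ha)] at hmem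
    rw [staircaseIdeal, Ideal.add_mem_iff_left _ (sum_mem fun a' ha' => ?_)] at hmem
    · obtain ⟨i, -, hi⟩ := (Ideal.IsPrime.prod_mem_iff (hp := hprime)).1
        (hprime.mem_of_pow_mem _ hmem)
      simp [X_mem_variableIdeal] at hi
    · obtain ⟨hne, ha'⟩ := Finset.mem_erase.1 ha'
      obtain ⟨i, hi⟩ : ∃ i, a' i < a i := by
        by_contra! hle
        refine hne (funext fun i => ?_)
        have := (Finset.sum_eq_sum_iff_of_le fun i _ => hle i).1 (ha.trans ((hF a').1 ha').symm)
        exact (this i (Finset.mem_univ i)).symm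
      refine Ideal.pow_mem_of_mem _ (Ideal.prod_mem _ (Finset.mem_univ i) ?_) _ (Nat.succ_pos _)
      exact X_mem_variableIdeal.2 hi
  · rw [Finset.sum_mul]
    refine sum_mem fun a ha => ?_
    rw [pow_succ', mul_assoc]
    exact Ideal.mul_mem_left _ _ (hs a ((hF a).1 ha))

end Jets

section LocalNilpotency

open Polynomial in
lemma Polynomial.coe_mul_eq_coe_imp_dvd {B : Type*} [CommRing B] {I : Ideal B}
    [IsHausdorff I B] {P T : B[X]} (hP : P.IsDistinguishedAt I) (hI : I ≠ ⊤) {Q : PowerSeries B}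
    (h : (T : PowerSeries B) = P * Q) : P ∣ T := by
  have hd := hP.isWeierstrassDivisorAt hI
  have horder : P.natDegree = ((P : PowerSeries B).map (Ideal.Quotient.mk I)).order.toNat := by
    have h1 : (P.natDegree : ℕ∞) = _ := hP.coe_natDegree_eq_order_map P 1
      (by rwa [map_one, ← Ideal.ne_top_iff_one]) (by simp)
    rw [← h1, ENat.toNat_natCast]
  have : Nontrivial B := ⟨0, 1, fun h => hI <| by
    rw [Ideal.eq_top_iff_one, ← h]; exact I.zero_mem⟩
  have key := hd.eq_zero_of_mul_eq (q := Q - ((T /ₘ P : B[X]) : PowerSeries B)) (r := T %ₘ P) ?_ ?_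
  · rw [← modByMonic_eq_zero_iff_dvd hP.monic]
    exact key.2
  · rw [← horder, ← degree_eq_natDegree hP.monic.ne_zero]
    exact degree_modByMonic_lt _ hP.monic
  · rw [mul_sub, ← h, modByMonic_eq_sub_mul_div]
    simp [Polynomial.coe_sub, Polynomial.coe_mul]

lemma isAdicComplete_of_pow_eq_bot {B : Type*} [CommRing B] {I : Ideal B} {r : ℕ}
    (h : I ^ r = ⊥) : IsAdicComplete I B where
  haus' x hx := by simpa [SModEq.zero, h] using hx r
  prec' f hf := by
    refine ⟨f r, fun n => ?_⟩
    rcases le_total n r with hn | hn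
    · exact hf hn
    · have := hf hn
      rw [h, Submodule.bot_smul, SModEq.bot] at this
      rw [this]

namespace PowerSeries

variable {B : Type*} [CommRing B]

lemma coeff_mul_sub_mem {I : Ideal B} {f g : PowerSeries B} {a b : ℕ}
    (hf : ∀ j < a, coeff j f ∈ I) (hg : ∀ j < b, coeff j g ∈ I) :
    coeff (a + b) (f * g) - coeff a f * coeff b g ∈ I := by
  classical
  rw [coeff_mul, ← Finset.add_sum_erase _ _ (a := (a, b)) (by simp), add_sub_cancel_left]
  refine sum_mem fun p hp => ?_
  rw [Finset.mem_erase, Finset.HasAntidiagonal.mem_antidiagonal, Ne, Prod.ext_iff] at hp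
  by_cases hp' : p.1 < a
  · exact I.mul_mem_right _ (hf _ hp')
  · exact I.mul_mem_left _ (hg _ (by omega))

lemma isUnit_of_sub_mem {I : Ideal B} (hI : I ≤ nilradical B) {x y : B} (hx : IsUnit x)
    (h : y - x ∈ I) : IsUnit y := by
  have := IsNilpotent.isUnit_add_left_of_commute (mem_nilradical.1 (hI h)) hx (Commute.all _ _)
  simpa using this

/-- Weierstrass preparation with respect to a nilpotent ideal. -/
lemma exists_isDistinguishedAt_mul_isUnit {I : Ideal B} [IsAdicComplete I B] (hI : I ≤ nilradical B)
    (hI' : I ≠ ⊤) {f : PowerSeries B} {a : ℕ} (hf : ∀ j < a, coeff j f ∈ I)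
    (hfa : IsUnit (coeff a f)) :
    ∃ (P : Polynomial B) (u : PowerSeries B), P.IsDistinguishedAt I ∧ P.natDegree = a ∧
      IsUnit u ∧ f = P * u := by
  have horder : (f.map (Ideal.Quotient.mk I)).order.toNat = a := by
    rw [(order_eq_nat (n := a)).2]
    · rfl
    · refine ⟨?_, fun i hi => ?_⟩
      · rw [coeff_map, Ne, Ideal.Quotient.eq_zero_iff_mem]
        exact fun h => hI' (Ideal.eq_top_of_isUnit_mem _ h hfa)
      · rw [coeff_map, Ideal.Quotient.eq_zero_iff_mem]
        exact hf i hi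
  have hd : f.IsWeierstrassDivisorAt I := by rwa [IsWeierstrassDivisorAt, horder]
  have hdiv := hd.isWeierstrassDivisionAt_div_mod (X ^ a)
  set q := hd.div (X ^ a)
  set r := hd.mod (X ^ a)
  have hrdeg := hdiv.degree_lt
  rw [horder] at hrdeg
  have hnt : Nontrivial B := ⟨0, 1, fun h => hI' <| by
    rw [Ideal.eq_top_iff_one, ← h]; exact I.zero_mem⟩
  have hP : ((Polynomial.X ^ a - r : Polynomial B) : PowerSeries B) = f * q := by
    rw [Polynomial.coe_sub, Polynomial.coe_pow, Polynomial.coe_X, hdiv.eq_mul_add]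
    ring
  have hmonic : (Polynomial.X ^ a - r).Monic := Polynomial.monic_X_pow_sub hrdeg
  have hnat : (Polynomial.X ^ a - r).natDegree = a := by
    apply Polynomial.natDegree_eq_of_degree_eq_some
    rw [Polynomial.degree_sub_eq_left_of_degree_lt] <;> simp [hrdeg]
  have hq : IsUnit q := by
    rw [isUnit_iff_constantCoeff, ← coeff_zero_eq_constantCoeff_apply]
    have h := coeff_mul_sub_mem (b := 0) hf (g := q) (by simp)
    rw [← hP, Polynomial.coeff_coe, add_zero] at h
    have hlead := hmonic.coeff_natDegree
    rw [hnat] at hlead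
    rw [hlead, ← neg_mem_iff, neg_sub] at h
    exact isUnit_of_mul_isUnit_right (isUnit_of_sub_mem hI isUnit_one h)
  refine ⟨Polynomial.X ^ a - r, ((hq.unit⁻¹ : (PowerSeries B)ˣ) : PowerSeries B), ⟨⟨fun {j} hj => ?_⟩, hmonic⟩,
    hnat, Units.isUnit _, ?_⟩
  · rw [hnat] at hj
    have := hdiv.coeff_f_sub_r_mem (i := j) (by rwa [horder])
    rw [← Polynomial.coeff_coe]
    simpa using this
  · rw [hP, mul_assoc, IsUnit.mul_val_inv, mul_one]

end PowerSeries

end LocalNilpotency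

namespace Polynomial

universe u

lemma coeff_mem_pow_of_X_sub_C_mul {C : Type*} [CommRing C] {I J : Ideal C} {x : C} (hIJ : I ≤ J)
    (hx : x ∈ J) {R : C[X]} {r : ℕ}
    (hR : ∀ l ≤ r + 1, ((X - Polynomial.C x) * R).coeff (r + 1 - l) ∈ I ^ l) :
    ∀ l ≤ r, R.coeff (r - l) ∈ J ^ l := by
  intro l
  induction l with
  | zero => simp
  | succ l ih =>
    intro hl
    have h := Ideal.pow_right_mono hIJ (l + 1) (hR (l + 1) (by omega))
    obtain ⟨s, rfl⟩ : ∃ s, r = s + 1 + l := ⟨r - 1 - l, by omega⟩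
    have ih := ih (by omega)
    rw [show s + 1 + l + 1 - (l + 1) = s + 1 by omega, sub_mul, coeff_sub, coeff_X_mul,
      coeff_C_mul] at h
    rw [show s + 1 + l - l = s + 1 by omega] at ih
    rw [show s + 1 + l - (l + 1) = s by omega]
    have h' : x * R.coeff (s + 1) ∈ J ^ (l + 1) := by
      rw [pow_succ']
      exact Ideal.mul_mem_mul hx ih
    simpa using add_mem h h'

lemma sup_span_singleton_pow_eq_bot {C : Type*} [CommRing C] {I : Ideal C} {x : C} {R : C[X]}
    {r M : ℕ} (hmonic : R.Monic) (hdeg : R.natDegree = r)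
    (hR : ∀ l ≤ r, R.coeff (r - l) ∈ I ^ l) (hx : R.eval x = 0) (hI : I ^ (M + 1) = ⊥) :
    (I ⊔ Ideal.span {x}) ^ (M + r) = ⊥ := by
  have key : ∀ m k, M + r ≤ m + k → ∀ y ∈ I ^ k, x ^ m * y = 0 := by
    intro m
    induction m using Nat.strong_induction_on with
    | _ m ih =>
      intro k hk y hy
      rcases lt_or_ge m r with hm | hm
      · have : y ∈ I ^ (M + 1) := Ideal.pow_le_pow_right (by omega) hy
        rw [hI, Ideal.mem_bot] at this
        rw [this, mul_zero]
      · have hxr : x ^ r = -∑ j ∈ Finset.range r, R.coeff j * x ^ j := by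
          rw [eval_eq_sum_range, hdeg, Finset.sum_range_succ] at hx
          have hlead := hmonic.coeff_natDegree
          rw [hdeg] at hlead
          rw [hlead, one_mul] at hx
          exact eq_neg_of_add_eq_zero_right hx
        obtain ⟨m, rfl⟩ := Nat.exists_eq_add_of_le hm
        rw [pow_add, hxr, neg_mul, neg_mul, Finset.sum_mul, Finset.sum_mul, neg_eq_zero]
        refine Finset.sum_eq_zero fun j hj => ?_
        rw [Finset.mem_range] at hj
        have h₁ := hR (r - j) (by omega)
        rw [show r - (r - j) = j by omega] at h₁
        have h₂ := ih (m + j) (by omega) (r - j + k) (by omega) (R.coeff j * y)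
          (by rw [pow_add]; exact Ideal.mul_mem_mul h₁ hy)
        rw [← h₂]
        ring
  rw [← Submodule.add_eq_sup, add_pow, ← le_bot_iff, Ideal.sum_eq_sup, Finset.sup_le_iff]
  intro m hm
  rw [Finset.mem_range] at hm
  refine Ideal.mul_le_left.trans ?_
  rw [Ideal.span_singleton_pow, Ideal.mul_le]
  intro y hy z hz
  obtain ⟨w, rfl⟩ := Ideal.mem_span_singleton'.1 hz
  have := key (M + r - m) m (by omega) y hy
  rw [Ideal.mem_bot, mul_left_comm, mul_comm y, this, mul_zero]

theorem exists_algebra_filtration (a : ℕ) : ∀ {B : Type u} [CommRing B] (I : Ideal B) (R P : B[X])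
    (r M : ℕ) (_ : R.Monic) (_ : R.natDegree = r) (_ : ∀ l ≤ r, R.coeff (r - l) ∈ I ^ l)
    (_ : I ^ (M + 1) = ⊥) (_ : P.Monic) (_ : P.natDegree = a) (_ : P ∣ R),
    ∃ (C : Type u) (_ : CommRing C) (_ : Algebra B C) (J : Ideal C) (π : C →ₗ[B] B) (e : C),
      I.map (algebraMap B C) ≤ J ∧ J ^ (M + 1 + ∑ i ∈ Finset.range a, (r - 1 - i)) = ⊥ ∧
      (∀ j ≤ a, algebraMap B C (P.coeff j) ∈ J ^ (a - j)) ∧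
      e ∈ J ^ (∑ i ∈ Finset.range a, i) ∧ π e = 1 := by
  induction a with
  | zero =>
    intro B _ I R P r M _ _ _ hI _ _ _
    exact ⟨B, _, Algebra.id B, I, LinearMap.id, 1, by simp [Ideal.map_id], by simpa using hI,
      by simp, by simp, by simp⟩
  | succ a ih =>
    intro B _ I R P r M hR hr hRI hI hP hPa hPR
    have hnt : Nontrivial B := by
      by_contra h
      rw [not_nontrivial_iff_subsingleton] at h
      rw [Subsingleton.elim P 0, natDegree_zero] at hPa
      omega
    let B₁ := AdjoinRoot P
    let x : B₁ := AdjoinRoot.root P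
    let pb := AdjoinRoot.powerBasis' hP
    have hdim : pb.dim = a + 1 := hPa
    let π₀ : B₁ →ₗ[B] B := pb.basis.coord ⟨a, by omega⟩
    have hπ₀ : π₀ (x ^ a) = 1 := by
      have : pb.basis ⟨a, by omega⟩ = x ^ a := by
        rw [pb.basis_eq_pow]
        rfl
      rw [← this, Module.Basis.coord_apply, Module.Basis.repr_self, Finsupp.single_eq_same]
    have : Nontrivial B₁ := by
      by_contra h
      rw [not_nontrivial_iff_subsingleton] at h
      rw [Subsingleton.elim (x ^ a) 0, map_zero] at hπ₀
      exact zero_ne_one hπ₀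
    let f : B →+* B₁ := algebraMap B B₁
    have hPx : (P.map f).IsRoot x := by
      rw [IsRoot.def, eval_map]
      exact AdjoinRoot.eval₂_root P
    obtain ⟨P₁, hP₁⟩ := dvd_iff_isRoot.2 hPx
    obtain ⟨R₁, hR₁⟩ : P.map f ∣ R.map f := Polynomial.map_dvd f hPR
    have hmonX : (X - Polynomial.C x).Monic := monic_X_sub_C x
    have hP₁m : P₁.Monic := hmonX.of_mul_monic_left (hP₁ ▸ hP.map f)
    have hR₁m : R₁.Monic := (hP.map f).of_mul_monic_left (hR₁ ▸ hR.map f)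
    have hP₁d : P₁.natDegree = a := by
      have := congrArg natDegree hP₁
      rw [hP.natDegree_map, hmonX.natDegree_mul hP₁m, natDegree_X_sub_C, hPa] at this
      omega
    have hRx : R.map f = (X - Polynomial.C x) * (P₁ * R₁) := by rw [hR₁, hP₁, mul_assoc]
    have hPRm : (P₁ * R₁).Monic := hP₁m.mul hR₁m
    obtain ⟨r, rfl⟩ : ∃ s, r = s + 1 := by
      have := congrArg natDegree hRx
      rw [hR.natDegree_map, hmonX.natDegree_mul hPRm, natDegree_X_sub_C, hr] at this
      exact ⟨_, this.trans (add_comm _ _)⟩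
    have hPRd : (P₁ * R₁).natDegree = r := by
      have := congrArg natDegree hRx
      rw [hR.natDegree_map, hmonX.natDegree_mul hPRm, natDegree_X_sub_C, hr] at this
      omega
    have hRf : ∀ l ≤ r + 1, (R.map f).coeff (r + 1 - l) ∈ I.map f ^ l := by
      intro l hl
      rw [coeff_map, ← Ideal.map_pow]
      exact Ideal.mem_map_of_mem f (hRI l hl)
    have hxJ : x ∈ I.map f ⊔ Ideal.span {x} :=
      Ideal.mem_sup_right (Ideal.mem_span_singleton_self x)
    obtain ⟨C, _, _, J, π, e, h₁, h₂, h₃, h₄, h₅⟩ := ih (I.map f ⊔ Ideal.span {x}) (P₁ * R₁) P₁ r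
      (M + r) hPRm hPRd
      (coeff_mem_pow_of_X_sub_C_mul (I := I.map f) le_sup_left hxJ (hRx ▸ hRf))
      (sup_span_singleton_pow_eq_bot (r := r + 1) (M := M) (hR.map f) (by rw [hR.natDegree_map, hr])
        hRf
        (by rw [hRx]; simp) (by rw [← Ideal.map_pow, hI, Ideal.map_bot]))
      hP₁m hP₁d (dvd_mul_right _ _)
    let g : B₁ →+* C := algebraMap B₁ C
    let _ : Algebra B C := (g.comp f).toAlgebra
    have : IsScalarTower B B₁ C := IsScalarTower.of_algebraMap_eq fun _ => rfl
    have hgx : g x ∈ J := h₁ (Ideal.mem_map_of_mem g hxJ)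
    refine ⟨C, _, _, J, π₀ ∘ₗ π.restrictScalars B, g (x ^ a) * e, ?_, ?_, ?_, ?_, ?_⟩
    · rw [show algebraMap B C = g.comp f from rfl, ← Ideal.map_map]
      exact (Ideal.map_mono le_sup_left).trans h₁
    · rw [Finset.sum_range_succ', ← h₂]
      congr 1
      have : ∀ i, r + 1 - 1 - (i + 1) = r - 1 - i := fun i => by omega
      simp only [this]
      omega
    · intro j hj
      change g (f (P.coeff j)) ∈ _
      have hcoe := congrArg (fun p => g (p.coeff j)) hP₁
      simp only [coeff_map] at hcoe
      rw [hcoe]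
      have hlast : ∀ j ≤ a, g x * g (P₁.coeff j) ∈ J ^ (a + 1 - j) := by
        intro j hj
        rw [show a + 1 - j = a - j + 1 by omega, pow_succ']
        exact Ideal.mul_mem_mul hgx (h₃ j hj)
      have hlast' : g x * g (P₁.coeff j) ∈ J ^ (a + 1 - j) := by
        rcases Nat.lt_or_ge a j with hj' | hj'
        · rw [coeff_eq_zero_of_natDegree_lt (by omega), map_zero, mul_zero]
          exact zero_mem _
        · exact hlast j hj'
      rcases j with _ | j
      · simpa [sub_mul] using hlast'
      · rw [sub_mul, coeff_sub, coeff_X_mul, coeff_C_mul, map_sub, map_mul]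
        refine sub_mem ?_ hlast'
        rw [show a + 1 - (j + 1) = a - j by omega]
        exact h₃ j (by omega)
    · rw [Finset.sum_range_succ, add_comm, pow_add, map_pow]
      exact Ideal.mul_mem_mul (Ideal.pow_mem_pow hgx a) h₄
    · have : g (x ^ a) * e = x ^ a • e := (Algebra.smul_def _ _).symm
      rw [this, LinearMap.comp_apply, LinearMap.restrictScalars_apply, map_smul, h₅, smul_eq_mul,
        mul_one, hπ₀]

end Polynomial

section TwoFactors

open PowerSeries in
theorem PowerSeries.coeff_pow_eq_zero_of_coeff_mul_eq_zero {B : Type*} [CommRing B]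
    {f g : PowerSeries B} {a b p d : ℕ} (hf : ∀ j < a, IsNilpotent (coeff j f))
    (hfa : IsUnit (coeff a f)) (hg : ∀ j < b, IsNilpotent (coeff j g)) (hgb : IsUnit (coeff b g))
    (hfg : ∀ j < a + b, coeff j (f * g) = 0) (hp : p ≤ a) (hd : a * b < d * (a - p)) :
    coeff p f ^ d = 0 := by
  classical
  nontriviality B
  let I : Ideal B := Ideal.span ((Finset.range a).image fun j => coeff j f : Finset B)
  have hfI : ∀ j < a, coeff j f ∈ I := fun j hj =>
    Ideal.subset_span (Finset.mem_coe.2 (Finset.mem_image_of_mem _ (Finset.mem_range.2 hj)))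
  have hI : I ≤ nilradical B := by
    refine Ideal.span_le.2 fun x hx => ?_
    obtain ⟨j, hj, rfl⟩ := Finset.mem_image.1 (Finset.mem_coe.1 hx)
    exact hf j (Finset.mem_range.1 hj)
  have hI' : I ≠ ⊤ := fun h => by
    have : (1 : B) ∈ nilradical B := hI (h ▸ Submodule.mem_top)
    exact not_isNilpotent_one this
  obtain ⟨r, hr⟩ := (Ideal.FG.isNilpotent_iff_le_nilradical ⟨_, rfl⟩).2 hI
  have := isAdicComplete_of_pow_eq_bot hr
  obtain ⟨P, u, hP, hPa, hu, rfl⟩ := exists_isDistinguishedAt_mul_isUnit hI hI' hfI hfa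
  have hunit : IsUnit (coeff (a + b) ((P : PowerSeries B) * u * g)) :=
    isUnit_of_sub_mem le_rfl (hfa.mul hgb) (coeff_mul_sub_mem hf hg)
  obtain ⟨Z, hZ⟩ := X_pow_dvd_iff.2 hfg
  have hZu : IsUnit Z := by
    rw [isUnit_iff_constantCoeff, ← coeff_zero_eq_constantCoeff_apply]
    rw [hZ] at hunit
    simpa [coeff_X_pow_mul'] using hunit
  obtain ⟨Z', hZ'⟩ := hZu.exists_right_inv
  have hdvd : P ∣ Polynomial.X ^ (a + b) := by
    refine Polynomial.coe_mul_eq_coe_imp_dvd hP hI' (Q := u * g * Z') ?_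
    rw [Polynomial.coe_pow, Polynomial.coe_X, ← mul_assoc, ← mul_assoc, hZ, mul_assoc, hZ', mul_one]
  obtain ⟨C, _, _, J, π, e, -, h₂, h₃, h₄, h₅⟩ :=
    Polynomial.exists_algebra_filtration a (⊥ : Ideal B)
    (Polynomial.X ^ (a + b)) P (a + b) 0 (Polynomial.monic_X_pow _) (Polynomial.natDegree_X_pow _)
    (by
      intro l hl
      rcases Nat.eq_zero_or_pos l with rfl | hl'
      · simp
      · simp [Polynomial.coeff_X_pow, show a + b - l ≠ a + b by omega])
    (by simp) hP.monic hPa hdvd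
  have hmem : algebraMap B C (coeff p ((P : PowerSeries B) * u)) ∈ J ^ (a - p) := by
    rw [coeff_mul, map_sum]
    refine sum_mem fun q hq => ?_
    rw [Finset.HasAntidiagonal.mem_antidiagonal] at hq
    rw [map_mul, Polynomial.coeff_coe]
    exact Ideal.mul_mem_right _ _ (Ideal.pow_le_pow_right (by omega) (h₃ q.1 (by omega)))
  have hsum : (∑ i ∈ Finset.range a, (a + b - 1 - i)) = a * b + ∑ i ∈ Finset.range a, i := by
    rw [← Finset.sum_range_reflect (fun i => i)]
    rw [show a * b = ∑ _i ∈ Finset.range a, b by simp, ← Finset.sum_add_distrib]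
    refine Finset.sum_congr rfl fun i hi => ?_
    rw [Finset.mem_range] at hi
    omega
  have hzero : algebraMap B C (coeff p ((P : PowerSeries B) * u)) ^ d * e = 0 := by
    rw [← Ideal.mem_bot, ← h₂, hsum]
    refine Ideal.pow_le_pow_right ?_ ((pow_add J ((a - p) * d) _).symm ▸
      Ideal.mul_mem_mul ((pow_mul J _ d).symm ▸ Ideal.pow_mem_pow hmem d) h₄)
    rw [mul_comm (a - p)]
    omega
  rw [← map_pow, ← Algebra.smul_def] at hzero
  simpa [h₅] using congrArg π hzero

end TwoFactors

section UpperBound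

lemma isUnit_coeff_prod {B ι : Type*} [CommRing B] {f : ι → PowerSeries B} {a : ι → ℕ}
    (hu : ∀ i, IsUnit (PowerSeries.coeff (a i) (f i)))
    (hn : ∀ i, ∀ j < a i, IsNilpotent (PowerSeries.coeff j (f i))) (S : Finset ι) :
    IsUnit (PowerSeries.coeff (∑ i ∈ S, a i) (∏ i ∈ S, f i)) := by
  by_contra h
  obtain ⟨P, hP, hmem⟩ := exists_max_ideal_of_mem_nonunits h
  have := hP.isPrime
  exact coeff_prod_notMem P f a S (fun i _ j hj => nilpotent_iff_mem_prime.1 (hn i j hj) P this)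
    (fun i _ h' => hP.ne_top (Ideal.eq_top_of_isUnit_mem _ h' (hu i))) hmem

variable {K : Type*} [Field K] {ι : Type*} [Fintype ι]

lemma isNilpotent_coeff_of_coeff_prod_eq_zero {B : Type*} [CommRing B] {f : ι → PowerSeries B}
    {a : ι → ℕ} (hu : ∀ i, IsUnit (PowerSeries.coeff (a i) (f i)))
    (hf : ∀ k < ∑ i, a i, PowerSeries.coeff k (∏ i, f i) = 0) (i : ι) {j : ℕ} (hj : j < a i) :
    IsNilpotent (PowerSeries.coeff j (f i)) := by
  classical
  rw [nilpotent_iff_mem_prime]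
  intro P hP
  have hex : ∀ i, ∃ j, PowerSeries.coeff j (f i) ∉ P := fun i =>
    ⟨a i, fun h => hP.ne_top (Ideal.eq_top_of_isUnit_mem _ h (hu i))⟩
  have hle : ∀ i, Nat.find (hex i) ≤ a i := fun i => Nat.find_min' _ fun h =>
    hP.ne_top (Ideal.eq_top_of_isUnit_mem _ h (hu i))
  have hlt : ∀ i, ∀ j < Nat.find (hex i), PowerSeries.coeff j (f i) ∈ P := fun i j hj =>
    not_not.1 (Nat.find_min (hex i) hj)
  have hsum : ∑ i, Nat.find (hex i) = ∑ i, a i := by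
    refine le_antisymm (Finset.sum_le_sum fun i _ => hle i) (not_lt.1 fun h => ?_)
    refine coeff_prod_notMem P f (fun i => Nat.find (hex i)) Finset.univ (fun i _ => hlt i)
      (fun i _ => Nat.find_spec (hex i)) ?_
    rw [hf _ h]
    exact P.zero_mem
  have := (Finset.sum_eq_sum_iff_of_le fun i _ => hle i).1 hsum i (Finset.mem_univ i)
  exact hlt i j (this ▸ hj)

theorem coeff_pow_eq_zero_of_coeff_prod_eq_zero {B : Type*} [CommRing B] {f : ι → PowerSeries B}
    {a : ι → ℕ} (hu : ∀ i, IsUnit (PowerSeries.coeff (a i) (f i)))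
    (hf : ∀ k < ∑ i, a i, PowerSeries.coeff k (∏ i, f i) = 0) (i : ι) {p d : ℕ} (hp : p ≤ a i)
    (hd : a i * (∑ j, a j - a i) < d * (a i - p)) : PowerSeries.coeff p (f i) ^ d = 0 := by
  classical
  have hn : ∀ i, ∀ j < a i, IsNilpotent (PowerSeries.coeff j (f i)) :=
    fun i _ hj => isNilpotent_coeff_of_coeff_prod_eq_zero hu hf i hj
  have hsum := Finset.add_sum_erase Finset.univ a (Finset.mem_univ i)
  refine PowerSeries.coeff_pow_eq_zero_of_coeff_mul_eq_zero (b := ∑ j ∈ Finset.univ.erase i, a j)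
    (g := ∏ j ∈ Finset.univ.erase i, f j) (hn i) (hu i) ?_
    (isUnit_coeff_prod hu hn _) ?_ hp (by rwa [← hsum, Nat.add_sub_cancel_left] at hd)
  · exact coeff_prod_mem (nilradical B) f a _ fun i _ j hj => mem_nilradical.2 (hn i j hj)
  · rwa [Finset.mul_prod_erase _ _ (Finset.mem_univ i), hsum]

theorem prod_X_pow_mem_jetIdeal (h : ι → ℕ) {d : ℕ}
    (hd : ∀ i, (h i + 1) * (∑ j, h j - h i) < d) :
    (∏ i, (X (i, h i) : MvPolynomial (ι × ℕ) K)) ^ d ∈ jetIdeal K ι (∑ i, h i + 1) := by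
  classical
  refine mem_jetIdeal_of_forall_prod_pow_mul_mem fun a ha => ?_
  set J := jetIdeal K ι (∑ i, h i + 1) with hJ
  let v := Ideal.Quotient.mk J (∏ i, X (i, a i))
  let φ : MvPolynomial (ι × ℕ) K →+* Localization.Away v :=
    (algebraMap _ (Localization.Away v)).comp (Ideal.Quotient.mk J)
  suffices hφ : φ ((∏ i, X (i, h i)) ^ d) = 0 by
    obtain ⟨⟨_, s, rfl⟩, hs⟩ := (IsLocalization.map_eq_zero_iff (Submonoid.powers v) _ _).1 hφ
    refine ⟨s, ?_⟩
    rw [← Ideal.Quotient.eq_zero_iff_mem, map_mul, map_pow]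
    exact hs
  have hu : ∀ i, IsUnit (PowerSeries.coeff (a i) ((genericSeries K i).map φ)) := by
    have : IsUnit (∏ i, φ (X (i, a i))) := by
      rw [← map_prod]
      exact IsLocalization.Away.algebraMap_isUnit v
    intro i
    rw [PowerSeries.coeff_map, genericSeries, PowerSeries.coeff_mk]
    exact isUnit_of_dvd_unit (Finset.dvd_prod_of_mem
      (fun i => φ (X (i, a i))) (Finset.mem_univ i)) this
  have hf : ∀ k < ∑ i, a i, PowerSeries.coeff k (∏ i, (genericSeries K i).map φ) = 0 := by
    intro k hk
    rw [← map_prod, PowerSeries.coeff_map, RingHom.comp_apply, Ideal.Quotient.eq_zero_iff_mem.2,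
      map_zero]
    exact Ideal.subset_span ⟨k, by rwa [← ha], rfl⟩
  obtain ⟨i, -, hi⟩ : ∃ i ∈ Finset.univ, h i < a i :=
    Finset.exists_lt_of_sum_lt (by rw [ha]; exact Nat.lt_succ_self _)
  have key := coeff_pow_eq_zero_of_coeff_prod_eq_zero hu hf i hi.le (d := d) ?_
  · rw [PowerSeries.coeff_map, genericSeries, PowerSeries.coeff_mk] at key
    rw [map_pow, map_prod, ← Finset.mul_prod_erase _ _ (Finset.mem_univ i), mul_pow, key, zero_mul]
  · rw [ha]
    have hle : a i ≤ ∑ j, h j + 1 := ha ▸ Finset.single_le_sum (fun _ _ => Nat.zero_le _)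
      (Finset.mem_univ i)
    specialize hd i
    obtain ⟨s, hs⟩ := Nat.exists_eq_add_of_lt hi
    obtain ⟨b, hb⟩ := Nat.exists_eq_add_of_le hle
    rw [show ∑ j, h j - h i = b + s by omega] at hd
    rw [show ∑ j, h j + 1 - a i = b by omega, show a i - h i = s + 1 by omega, hs]
    nlinarith [Nat.zero_le (h i * s * b), Nat.zero_le (h i * s * s), Nat.zero_le (h i * s),
      Nat.zero_le (s * s)]

end UpperBound

section Antisymmetrization

lemma eq_of_injective_of_le {σ : Type*} [Fintype σ] {δ m : σ → ℕ} (hδ : Function.Injective δ)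
    (hδc : ∀ z, δ z < Fintype.card σ) (hm : Function.Injective m) (h : ∀ z, m z ≤ δ z) : m = δ := by
  have himg : Finset.univ.image δ = Finset.range (Fintype.card σ) :=
    Finset.eq_of_subset_of_card_le
      (fun _ hx => by
        obtain ⟨z, -, rfl⟩ := Finset.mem_image.1 hx
        exact Finset.mem_range.2 (hδc z))
      (by rw [Finset.card_image_of_injective _ hδ, Finset.card_range, Finset.card_univ])
  have key : ∀ n z, δ z = n → m z = n := by
    intro n
    induction n using Nat.strong_induction_on with
    | _ n ih =>
      intro z hz
      refine (hz ▸ h z).eq_of_not_lt fun hlt => ?_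
      have : m z ∈ Finset.univ.image δ := by
        rw [himg, Finset.mem_range]
        exact (h z).trans_lt (hδc z)
      obtain ⟨y, -, hy⟩ := Finset.mem_image.1 this
      have := hm (ih (m z) hlt y hy)
      rw [this] at hy
      omega
  exact funext fun z => key _ z rfl

lemma rename_swap_monomial {σ K : Type*} [DecidableEq σ] [Field K] {z z' : σ} {m : σ →₀ ℕ}
    (hm : m z = m z') :
    rename (Equiv.swap z z') (monomial m (1 : K)) = monomial m 1 := by
  have : m.mapDomain (Equiv.swap z z') = m := by
    ext y
    rw [Finsupp.mapDomain_equiv_apply, Equiv.symm_swap]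
    rcases eq_or_ne y z with rfl | h₁
    · simp [hm]
    · rcases eq_or_ne y z' with rfl | h₂
      · simp [hm]
      · rw [Equiv.swap_apply_of_ne_of_ne h₁ h₂]
  rw [rename_monomial, this]

lemma perm_eq_one_of_strictMonoOn {σ : Type*} {δ : σ → ℕ} (hδ : Function.Injective δ) {T : Finset σ}
    {m : σ → ℕ} (hmT : ∀ z ∉ T, m z = δ z)
    (hmono : ∀ z ∈ T, ∀ z' ∈ T, δ z < δ z' → m z < m z') {w : Equiv.Perm σ}
    (hw : ∀ z, δ (w z) = m z) : w = 1 := by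
  have hfix : ∀ z ∉ T, w z = z := fun z hz => hδ ((hw z).trans (hmT z hz))
  have key : ∀ n z, δ z = n → w z = z := by
    intro n
    induction n using Nat.strong_induction_on with
    | _ n ih =>
      intro z hz
      by_contra hne
      rcases lt_trichotomy (δ (w z)) (δ z) with hlt | heq | hlt
      · exact hne (w.injective (ih _ (hz ▸ hlt) (w z) rfl))
      · exact hne (hδ heq)
      · obtain ⟨y, rfl⟩ := w.surjective z
        have hy : y ≠ w y := fun h => hne (by rw [← h, ← h])
        have hyT : y ∈ T := by
          by_contra h
          exact hy (hfix y h).symm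
        have hzT : w y ∈ T := by
          by_contra h
          exact hne (hfix _ h)
        rcases lt_trichotomy (δ y) (δ (w y)) with h | h | h
        · exact hy (ih _ (hz ▸ h) y rfl).symm
        · exact hy (hδ h)
        · have := hmono _ hzT _ hyT h
          rw [← hw, ← hw] at this
          omega
  ext z
  exact key _ z rfl

variable {σ : Type*} [Fintype σ] [DecidableEq σ] {K : Type*} [Field K]

/-- The signed sum of the coefficients at all permutations of the exponent `δ`. -/
noncomputable def alternatingCoeff (K : Type*) [Field K] (δ : σ → ℕ) : MvPolynomial σ K →ₗ[K] K :=
  ∑ w : Equiv.Perm σ, ((w.sign : ℤ) : K) • lcoeff K (Finsupp.equivFunOnFinite.symm (δ ∘ w))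

lemma alternatingCoeff_apply (δ : σ → ℕ) (p : MvPolynomial σ K) :
    alternatingCoeff K δ p =
      ∑ w : Equiv.Perm σ, ((w.sign : ℤ) : K) * coeff (Finsupp.equivFunOnFinite.symm (δ ∘ w)) p := by
  simp [alternatingCoeff]

lemma alternatingCoeff_rename (δ : σ → ℕ) (τ : Equiv.Perm σ) (p : MvPolynomial σ K) :
    alternatingCoeff K δ (rename τ p) = ((τ.sign : ℤ) : K) * alternatingCoeff K δ p := by
  rw [alternatingCoeff_apply, alternatingCoeff_apply, Finset.mul_sum,
    ← Equiv.sum_comp (Equiv.mulRight τ)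
      (fun w => ((τ.sign : ℤ) : K) * (((w.sign : ℤ) : K) *
        coeff (Finsupp.equivFunOnFinite.symm (δ ∘ w)) p))]
  refine Finset.sum_congr rfl fun w _ => ?_
  have h₁ : (Finsupp.equivFunOnFinite.symm (δ ∘ w) : σ →₀ ℕ) =
      (Finsupp.equivFunOnFinite.symm (δ ∘ (w * τ : Equiv.Perm σ))).mapDomain τ := by
    ext z
    rw [Finsupp.mapDomain_equiv_apply]
    simp
  have h₂ : ((τ.sign : ℤ) : K) * ((τ.sign : ℤ) : K) = 1 := by
    rw [← Int.cast_mul, Int.units_coe_mul_self, Int.cast_one]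
  rw [h₁, coeff_rename_mapDomain _ τ.injective]
  simp only [Equiv.coe_mulRight, Equiv.Perm.sign_mul, Units.val_mul, Int.cast_mul]
  linear_combination (-((w.sign : ℤ) : K) *
    coeff (Finsupp.equivFunOnFinite.symm (δ ∘ (w * τ : Equiv.Perm σ))) p) * h₂

lemma alternatingCoeff_eq_zero_of_swap [CharZero K] (δ : σ → ℕ) {z z' : σ} (hz : z ≠ z')
    {p : MvPolynomial σ K} (hp : rename (Equiv.swap z z') p = p) : alternatingCoeff K δ p = 0 := by
  have := alternatingCoeff_rename δ (Equiv.swap z z') p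
  rw [hp, Equiv.Perm.sign_swap hz] at this
  simpa [self_eq_neg] using this

lemma alternatingCoeff_mul_eq_zero [CharZero K] {δ : σ → ℕ} (hδ : Function.Injective δ)
    (hδc : ∀ z, δ z < Fintype.card σ) {s : MvPolynomial σ K} (hs : s.IsSymmetric)
    (hs0 : constantCoeff s = 0) (q : MvPolynomial σ K) : alternatingCoeff K δ (q * s) = 0 := by
  induction q using MvPolynomial.induction_on' with
  | add p q hp hq => rw [add_mul, map_add, hp, hq, add_zero]
  | monomial m c =>
    rw [show monomial m c = c • monomial m (1 : K) by rw [smul_monomial, smul_eq_mul, mul_one],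
      smul_mul_assoc, map_smul]
    refine smul_eq_zero_of_right _ ?_
    by_cases hm : Function.Injective m
    · rw [alternatingCoeff_apply]
      refine Finset.sum_eq_zero fun w _ => mul_eq_zero_of_right _ ?_
      rw [coeff_monomial_mul']
      split_ifs with hle
      · have : (m : σ → ℕ) = δ ∘ w := eq_of_injective_of_le (hδ.comp w.injective)
          (fun z => hδc _) hm fun z => by simpa using hle z
        have h : (Finsupp.equivFunOnFinite.symm (δ ∘ w) : σ →₀ ℕ) = m := by
          ext z
          simp [this]
        rw [h, tsub_self, one_mul, ← constantCoeff_eq, hs0]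
      · rfl
    · simp only [Function.Injective, not_forall] at hm
      obtain ⟨z, z', hzz, hne⟩ := hm
      refine alternatingCoeff_eq_zero_of_swap δ hne ?_
      rw [map_mul, rename_swap_monomial hzz, hs]

lemma alternatingCoeff_eq_zero_of_mem_span [CharZero K] {δ : σ → ℕ} (hδ : Function.Injective δ)
    (hδc : ∀ z, δ z < Fintype.card σ) {S : Set (MvPolynomial σ K)}
    (hS : ∀ s ∈ S, s.IsSymmetric ∧ constantCoeff s = 0) {p : MvPolynomial σ K}
    (hp : p ∈ Ideal.span S) : alternatingCoeff K δ p = 0 := by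
  suffices ∀ q, alternatingCoeff K δ (q * p) = 0 by simpa using this 1
  induction hp using Submodule.span_induction with
  | mem s hs => exact alternatingCoeff_mul_eq_zero hδ hδc (hS s hs).1 (hS s hs).2
  | zero => simp
  | add p p' _ _ h h' => intro q; rw [mul_add, map_add, h, h', add_zero]
  | smul r p _ h => intro q; rw [smul_eq_mul, ← mul_assoc]; exact h _

lemma alternatingCoeff_sum_pow_mul_monomial [CharZero K] {δ : σ → ℕ} (hδ : Function.Injective δ)
    (T : Finset σ) (k : ℕ) : ∀ (m : σ →₀ ℕ) (_ : ∀ z ∉ T, m z = δ z)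
      (_ : ∀ z ∈ T, ∀ z' ∈ T, δ z < δ z' → m z < m z'),
      ∃ c : ℕ, alternatingCoeff K δ ((∑ z ∈ T, X z) ^ k * monomial m 1) = c ∧
        ((∀ z ∈ T, m z ≤ δ z) → ∑ z, m z + k = ∑ z, δ z → c ≠ 0) := by
  induction k with
  | zero =>
    intro m hmT hmono
    rw [pow_zero, one_mul, alternatingCoeff_apply]
    have hzero : ∀ w : Equiv.Perm σ, (w ≠ 1 ∨ (m : σ → ℕ) ≠ δ) →
        ((w.sign : ℤ) : K) * coeff (Finsupp.equivFunOnFinite.symm (δ ∘ w)) (monomial m 1) = 0 := by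
      intro w hw
      rw [coeff_monomial, if_neg, mul_zero]
      rintro rfl
      have h1 : w = 1 := perm_eq_one_of_strictMonoOn hδ hmT hmono fun z => rfl
      exact hw.elim (· h1) fun h => h (by rw [h1]; rfl)
    by_cases hm : (m : σ → ℕ) = δ
    · refine ⟨1, ?_, fun _ _ => one_ne_zero⟩
      rw [Finset.sum_eq_single 1 (fun w _ hw => hzero w (.inl hw)) (by simp)]
      have : (Finsupp.equivFunOnFinite.symm (δ ∘ (1 : Equiv.Perm σ)) : σ →₀ ℕ) = m := by
        ext z
        simp [hm]
      rw [this, coeff_monomial]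
      simp
    · refine ⟨0, ?_, fun hle hsum => absurd ?_ hm⟩
      · rw [Finset.sum_eq_zero fun w _ => hzero w (.inr hm), Nat.cast_zero]
      · have hle' : ∀ z ∈ Finset.univ, m z ≤ δ z := fun z _ =>
          if h : z ∈ T then hle z h else (hmT z h).le
        exact funext fun z => (Finset.sum_eq_sum_iff_of_le hle').1 hsum z (Finset.mem_univ z)
  | succ k ih =>
    intro m hmT hmono
    have hstep : alternatingCoeff K δ ((∑ z ∈ T, X z) ^ (k + 1) * monomial m 1) =
        ∑ i ∈ T, alternatingCoeff K δ
          ((∑ z ∈ T, X z) ^ k * monomial (m + Finsupp.single i 1) 1) := by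
      rw [pow_succ, mul_assoc, Finset.sum_mul, Finset.mul_sum, map_sum]
      refine Finset.sum_congr rfl fun i _ => ?_
      rw [X, monomial_mul, one_mul, add_comm]
    have hval : ∀ i z, (m + Finsupp.single i 1 : σ →₀ ℕ) z = m z + if i = z then 1 else 0 := by
      intro i z
      simp [Finsupp.single_apply]
    have hmT' : ∀ i ∈ T, ∀ z ∉ T, (m + Finsupp.single i 1 : σ →₀ ℕ) z = δ z := by
      intro i hi z hz
      rw [hval, if_neg (by rintro rfl; exact hz hi), add_zero, hmT z hz]
    have hnat : ∀ i ∈ T, ∃ c : ℕ, alternatingCoeff K δ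
        ((∑ z ∈ T, X z) ^ k * monomial (m + Finsupp.single i 1) 1) = c ∧
        ((∀ z ∈ T, (m + Finsupp.single i 1 : σ →₀ ℕ) z ≤ δ z) →
          (∀ z ∈ T, δ i < δ z → m i + 1 < m z) →
          ∑ z, (m + Finsupp.single i 1 : σ →₀ ℕ) z + k = ∑ z, δ z → c ≠ 0) := by
      intro i hi
      by_cases hi' : ∃ z ∈ T, δ i < δ z ∧ m z = m i + 1
      · obtain ⟨z, hz, hlt, heq⟩ := hi'
        refine ⟨0, ?_, fun _ h => absurd heq (h z hz hlt).ne'⟩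
        have hne : i ≠ z := by rintro rfl; omega
        rw [Nat.cast_zero]
        refine alternatingCoeff_eq_zero_of_swap δ hne ?_
        rw [map_mul, map_pow, map_sum, rename_swap_monomial (by rw [hval, hval]; simp [heq, hne])]
        simp only [rename_X]
        congr 2
        refine Finset.sum_equiv (Equiv.swap i z) (fun y => ?_) fun _ _ => rfl
        rcases eq_or_ne y i with rfl | h₁
        · simp [hi, hz]
        · rcases eq_or_ne y z with rfl | h₂
          · simp [hi, hz]
          · rw [Equiv.swap_apply_of_ne_of_ne h₁ h₂]
      · push Not at hi'
        obtain ⟨c, hc, hc'⟩ := ih (m + Finsupp.single i 1) (hmT' i hi) (by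
          intro z hz z' hz' hlt
          have := hmono z hz z' hz' hlt
          rw [hval, hval]
          rcases eq_or_ne i z with rfl | h
          · have := hi' z' hz' hlt
            simp only [if_true]
            omega
          · rw [if_neg h]
            omega)
        exact ⟨c, hc, fun h _ => hc' h⟩
    choose! c hc hc' using hnat
    refine ⟨∑ i ∈ T, c i, ?_, fun hle hsum => ?_⟩
    · rw [hstep, Nat.cast_sum]
      exact Finset.sum_congr rfl hc
    · have hne : (T.filter fun z => m z < δ z).Nonempty := by
        by_contra h
        rw [Finset.not_nonempty_iff_eq_empty, Finset.filter_eq_empty_iff] at h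
        have : ∑ z, δ z ≤ ∑ z, m z := Finset.sum_le_sum fun z _ =>
          if hz : z ∈ T then not_lt.1 (h hz) else (hmT z hz).ge
        omega
      obtain ⟨i, hi, hmax⟩ := Finset.exists_max_image _ δ hne
      rw [Finset.mem_filter] at hi
      have hci : c i ≠ 0 := by
        refine hc' i hi.1 (fun z hz => ?_) (fun z hz hlt => ?_) ?_
        · rw [hval]
          have := hle z hz
          split_ifs with h
          · subst h
            omega
          · omega
        · have hz' : δ z ≤ m z := by
            by_contra h
            exact absurd (hmax z (Finset.mem_filter.2 ⟨hz, not_le.1 h⟩)) (not_le.2 hlt)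
          omega
        · simp only [hval, Finset.sum_add_distrib, Finset.sum_ite_eq, Finset.mem_univ, if_true]
          omega
      exact (Finset.sum_pos' (fun _ _ => Nat.zero_le _) ⟨i, hi.1, Nat.pos_of_ne_zero hci⟩).ne'

theorem sum_X_pow_notMem_span [CharZero K] (T : Finset σ) {b : ℕ}
    (hb : T.card + b = Fintype.card σ) {S : Set (MvPolynomial σ K)}
    (hS : ∀ s ∈ S, s.IsSymmetric ∧ constantCoeff s = 0) :
    (∑ z ∈ T, X z : MvPolynomial σ K) ^ (T.card * b) ∉ Ideal.span S := by
  intro hmem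
  have hcompl : (Tᶜ).card = b := by rw [Finset.card_compl]; omega
  let δ : σ → ℕ := fun z => if h : z ∈ T then b + T.equivFin ⟨z, h⟩ else
    (Tᶜ).equivFin ⟨z, Finset.mem_compl.2 h⟩
  have hδT : ∀ z ∈ T, b ≤ δ z := fun z hz => by simp [δ, hz]
  have hδT' : ∀ z ∉ T, δ z < b := fun z hz => by
    simp only [δ, hz, dif_neg, not_false_eq_true]
    exact hcompl ▸ Fin.isLt _
  have hδc : ∀ z, δ z < Fintype.card σ := fun z => by
    by_cases hz : z ∈ T
    · have := (T.equivFin ⟨z, hz⟩).isLt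
      simp only [δ, hz, dif_pos]
      omega
    · exact (hδT' z hz).trans_le (by omega)
  have hδ : Function.Injective δ := by
    intro z z' h
    by_cases hz : z ∈ T <;> by_cases hz' : z' ∈ T
    · simpa [δ, hz, hz', Fin.val_inj] using h
    · have := hδT z hz
      have := hδT' z' hz'
      omega
    · have := hδT z' hz'
      have := hδT' z hz
      omega
    · simpa [δ, hz, hz', Fin.val_inj] using h
  let m : σ →₀ ℕ := Finsupp.equivFunOnFinite.symm fun z => if z ∈ T then δ z - b else δ z
  have hm : ∀ z, m z = if z ∈ T then δ z - b else δ z := fun z => rfl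
  obtain ⟨c, hc, hc'⟩ := alternatingCoeff_sum_pow_mul_monomial (K := K) hδ T (T.card * b) m
    (fun z hz => by rw [hm, if_neg hz])
    (fun z hz z' hz' hlt => by
      have := hδT z hz
      have := hδT z' hz'
      rw [hm, hm, if_pos hz, if_pos hz']
      omega)
  rw [alternatingCoeff_eq_zero_of_mem_span hδ hδc hS (Ideal.mul_mem_right _ _ hmem)] at hc
  refine hc' (fun z hz => ?_) ?_ (by exact_mod_cast hc.symm)
  · rw [hm, if_pos hz]
    omega
  · have hcard : T.card * b = ∑ z, if z ∈ T then b else 0 := by simp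
    rw [hcard, ← Finset.sum_add_distrib]
    refine Finset.sum_congr rfl fun z _ => ?_
    rw [hm]
    split_ifs with hz
    · exact Nat.sub_add_cancel (hδT z hz)
    · rfl

end Antisymmetrization

section LowerBound

variable {K : Type*} [Field K] {ι : Type*} [Fintype ι]

lemma constantCoeff_esymm {σ : Type*} [Fintype σ] {n : ℕ} (hn : n ≠ 0) :
    constantCoeff (esymm σ K n) = 0 := by
  rw [esymm, map_sum]
  refine Finset.sum_eq_zero fun t ht => ?_
  obtain ⟨z, hz⟩ : t.Nonempty := by
    rw [← Finset.card_pos, (Finset.mem_powersetCard.1 ht).2]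
    omega
  rw [map_prod]
  exact Finset.prod_eq_zero hz (constantCoeff_X K z)

theorem prod_X_pow_notMem_jetIdeal [CharZero K] (h : ι → ℕ) (i₀ : ι) :
    (∏ i, (X (i, h i) : MvPolynomial (ι × ℕ) K)) ^ ((h i₀ + 1) * (∑ j, h j - h i₀)) ∉
      jetIdeal K ι (∑ i, h i + 1) := by
  classical
  let a : ι → ℕ := Function.update h i₀ (h i₀ + 1)
  let σ := Σ j, Fin (a j)
  have ha₀ : a i₀ = h i₀ + 1 := Function.update_self _ _ _
  have ha : ∀ j ≠ i₀, a j = h j := fun j hj => Function.update_of_ne hj _ _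
  have hcard : Fintype.card σ = ∑ j, h j + 1 := by
    rw [Fintype.card_sigma, ← Finset.add_sum_erase _ h (Finset.mem_univ i₀),
      ← Finset.add_sum_erase _ _ (Finset.mem_univ i₀), Fintype.card_fin, ha₀, add_right_comm]
    congr 2
    refine Finset.sum_congr rfl fun j hj => ?_
    rw [Fintype.card_fin, ha j (Finset.ne_of_mem_erase hj)]
  let p : ι → Polynomial (MvPolynomial σ K) := fun j =>
    ∏ z : Fin (a j), (Polynomial.X + Polynomial.C (X ⟨j, z⟩))
  have hmonic : ∀ j (z : Fin (a j)),
      (Polynomial.X + Polynomial.C (X ⟨j, z⟩ : MvPolynomial σ K)).Monic :=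
    fun j z => Polynomial.monic_X_add_C _
  have hpm : ∀ j, (p j).Monic := fun j => Polynomial.monic_prod_of_monic _ _ fun z _ => hmonic j z
  have hpd : ∀ j, (p j).natDegree = a j := fun j => by
    simp only [p]
    rw [Polynomial.natDegree_prod_of_monic _ _ fun z _ => hmonic j z]
    simp
  let φ : MvPolynomial (ι × ℕ) K →ₐ[K] MvPolynomial σ K := aeval fun q => (p q.1).coeff q.2
  have hφX : ∀ q, φ (X q) = (p q.1).coeff q.2 := aeval_X _
  have hφ : ∀ i, (genericSeries K i).map (φ : MvPolynomial (ι × ℕ) K →+* MvPolynomial σ K) =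
      (p i : PowerSeries (MvPolynomial σ K)) := by
    intro i
    ext1 j
    rw [PowerSeries.coeff_map, genericSeries, PowerSeries.coeff_mk, Polynomial.coeff_coe]
    exact hφX _
  let T : Finset σ := Finset.univ.map (Function.Embedding.sigmaMk i₀)
  have hT : T.card = h i₀ + 1 := by simp [T, ha₀]
  have hle : h i₀ ≤ ∑ j, h j :=
    Finset.single_le_sum (fun _ _ => Nat.zero_le _) (Finset.mem_univ i₀)
  have hφf : φ (∏ i, X (i, h i)) = ∑ z ∈ T, X z := by
    rw [map_prod, ← Finset.mul_prod_erase _ _ (Finset.mem_univ i₀), Finset.prod_eq_one, mul_one,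
      hφX, Finset.sum_map]
    · have hnext : (p i₀).nextCoeff = ∑ z : Fin (a i₀), X ⟨i₀, z⟩ := by
        simp only [p]
        rw [Polynomial.Monic.nextCoeff_prod _ _ fun z _ => hmonic i₀ z]
        exact Finset.sum_congr rfl fun z _ => Polynomial.nextCoeff_X_add_C _
      have ha₀' : a i₀ - 1 = h i₀ := by rw [ha₀, Nat.add_sub_cancel]
      rw [Polynomial.nextCoeff_of_natDegree_pos (by rw [hpd, ha₀]; omega), hpd, ha₀'] at hnext
      exact hnext
    · intro j hj
      have := (hpm j).coeff_natDegree
      rw [hpd, ha j (Finset.ne_of_mem_erase hj)] at this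
      rw [hφX]
      exact this
  intro hmem
  have := Ideal.mem_map_of_mem (φ : MvPolynomial (ι × ℕ) K →+* MvPolynomial σ K) hmem
  rw [jetIdeal, Ideal.map_span, map_pow, RingHom.coe_coe, hφf, ← hT] at this
  refine sum_X_pow_notMem_span T (by omega) ?_ this
  rintro _ ⟨_, ⟨k, hk, rfl⟩, rfl⟩
  have hk : k < Fintype.card σ := by rw [hcard]; exact hk
  have hcoeff : φ (PowerSeries.coeff k (∏ i, genericSeries K i)) =
      esymm σ K (Fintype.card σ - k) := by
    have h₁ := congrArg (PowerSeries.coeff k) (map_prod (PowerSeries.map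
      (φ : MvPolynomial (ι × ℕ) K →+* MvPolynomial σ K)) (genericSeries K) Finset.univ)
    simp only [hφ] at h₁
    rw [PowerSeries.coeff_map] at h₁
    refine h₁.trans ?_
    rw [← prod_X_add_C_coeff K σ k hk.le, Fintype.prod_sigma, ← Polynomial.coeff_coe]
    congr 1
    exact (map_prod Polynomial.coeToPowerSeries.ringHom p Finset.univ).symm
  simp only [hcoeff]
  exact ⟨esymm_isSymmetric σ K _, constantCoeff_esymm (by omega)⟩

end LowerBound

section TaylorSeries

variable {K A : Type*} [Field K] [CommRing A] [Algebra K A]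

/-- The Taylor series `∑ D ^ k f / k! t ^ k` of `f` along the derivation `D`. -/
noncomputable def taylorSeries (D : Derivation K A A) (f : A) : PowerSeries A :=
  PowerSeries.mk fun k => ((k.factorial : K)⁻¹) • (⇑D)^[k] f

lemma coeff_taylorSeries (D : Derivation K A A) (f : A) (k : ℕ) :
    PowerSeries.coeff k (taylorSeries D f) = ((k.factorial : K)⁻¹) • (⇑D)^[k] f :=
  PowerSeries.coeff_mk _ _

lemma taylorSeries_add (D : Derivation K A A) (f g : A) :
    taylorSeries D (f + g) = taylorSeries D f + taylorSeries D g := by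
  ext1 k
  rw [map_add, coeff_taylorSeries, coeff_taylorSeries, coeff_taylorSeries, iterate_map_add,
    smul_add]

lemma taylorSeries_one (D : Derivation K A A) : taylorSeries D 1 = 1 := by
  ext1 k
  rw [coeff_taylorSeries, PowerSeries.coeff_one]
  cases k with
  | zero => simp
  | succ k => simp [iterate_map_zero]

variable [CharZero K]

lemma derivative_taylorSeries (D : Derivation K A A) (f : A) :
    PowerSeries.derivative A (taylorSeries D f) = taylorSeries D (D f) := by
  ext1 k
  rw [PowerSeries.coeff_derivative, coeff_taylorSeries, coeff_taylorSeries,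
    ← Function.iterate_succ_apply, mul_comm, ← Nat.cast_succ, ← nsmul_eq_mul,
    ← Nat.cast_smul_eq_nsmul K, smul_smul]
  congr 1
  have : ((k + 1 : ℕ) : K) ≠ 0 := Nat.cast_ne_zero.2 k.succ_ne_zero
  rw [Nat.factorial_succ, Nat.cast_mul, mul_inv, mul_inv_cancel_left₀ this]

lemma taylorSeries_mul (D : Derivation K A A) (f g : A) :
    taylorSeries D (f * g) = taylorSeries D f * taylorSeries D g := by
  ext1 k
  induction k generalizing f g with
  | zero => simp [PowerSeries.coeff_mul, coeff_taylorSeries]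
  | succ k ih =>
    have key : PowerSeries.coeff k (PowerSeries.derivative A (taylorSeries D (f * g))) =
        PowerSeries.coeff k (PowerSeries.derivative A (taylorSeries D f * taylorSeries D g)) := by
      rw [derivative_taylorSeries, Derivation.leibniz, Derivation.leibniz, smul_eq_mul,
        smul_eq_mul, smul_eq_mul, smul_eq_mul, taylorSeries_add, map_add, map_add, ih, ih,
        derivative_taylorSeries, derivative_taylorSeries]
    rw [PowerSeries.coeff_derivative, PowerSeries.coeff_derivative, mul_comm, mul_comm _ (_ + _),
      ← Nat.cast_succ, ← nsmul_eq_mul, ← nsmul_eq_mul, ← Nat.cast_smul_eq_nsmul K,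
      ← Nat.cast_smul_eq_nsmul K] at key
    exact (IsUnit.mk0 _ (Nat.cast_ne_zero.2 k.succ_ne_zero)).smul_left_cancel.1 key

lemma taylorSeries_prod (D : Derivation K A A) {ι : Type*} (s : Finset ι) (f : ι → A) :
    taylorSeries D (∏ i ∈ s, f i) = ∏ i ∈ s, taylorSeries D (f i) := by
  induction s using Finset.cons_induction with
  | empty => simp [taylorSeries_one]
  | cons i s hi ih => rw [Finset.prod_cons, Finset.prod_cons, taylorSeries_mul, ih]

end TaylorSeries

section DifferentialIdeal

variable (K : Type*) [Field K] (ι : Type*)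

/-- The derivation with `X (i, j) ↦ X (i, j + 1)`. -/
noncomputable def shiftDerivation :
    Derivation K (MvPolynomial (ι × ℕ) K) (MvPolynomial (ι × ℕ) K) :=
  mkDerivation K fun p => X (p.1, p.2 + 1)

variable {ι} in
lemma shiftDerivation_iterate_X (i : ι) (k : ℕ) :
    (⇑(shiftDerivation K ι))^[k] (X (i, 0)) = X (i, k) := by
  induction k with
  | zero => rfl
  | succ k ih => rw [Function.iterate_succ_apply', ih, shiftDerivation, mkDerivation_X]

/-- The substitution `X (i, j) ↦ c j • X (i, j)`. -/
noncomputable def scaleVariables (c : ℕ → K) :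
    MvPolynomial (ι × ℕ) K →ₐ[K] MvPolynomial (ι × ℕ) K :=
  aeval fun p => c p.2 • X p

variable {K ι}

lemma scaleVariables_X (c : ℕ → K) (p : ι × ℕ) :
    scaleVariables K ι c (X p) = c p.2 • X p :=
  aeval_X _ _

lemma scaleVariables_comp {b c : ℕ → K} (hbc : ∀ j, b j * c j = 1) :
    (scaleVariables K ι b).comp (scaleVariables K ι c) = AlgHom.id K _ := by
  ext1 p
  rw [AlgHom.comp_apply, scaleVariables_X, map_smul, scaleVariables_X, smul_smul, mul_comm, hbc,
    one_smul, AlgHom.id_apply]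

variable [Fintype ι]

lemma scaleVariables_prod_X_pow (c : ℕ → K) (h : ι → ℕ) (d : ℕ) :
    scaleVariables K ι c ((∏ i, X (i, h i)) ^ d) =
      C ((∏ i, c (h i)) ^ d) * (∏ i, X (i, h i)) ^ d := by
  rw [map_pow, map_prod, map_pow, map_prod, ← mul_pow, ← Finset.prod_mul_distrib]
  simp_rw [scaleVariables_X, smul_eq_C_mul]

variable [CharZero K]

lemma scaleVariables_coeff_prod_genericSeries (k : ℕ) :
    scaleVariables K ι (fun j => (j.factorial : K)⁻¹)
        (PowerSeries.coeff k (∏ i, genericSeries K i)) =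
      ((k.factorial : K)⁻¹) • (⇑(shiftDerivation K ι))^[k] (∏ i, X (i, 0)) := by
  have hmap : ∀ i, (genericSeries K i).map
      (scaleVariables K ι (fun j => (j.factorial : K)⁻¹) : _ →+* MvPolynomial (ι × ℕ) K) =
      taylorSeries (shiftDerivation K ι) (X (i, 0)) := by
    intro i
    ext1 j
    rw [PowerSeries.coeff_map, genericSeries, PowerSeries.coeff_mk, coeff_taylorSeries,
      shiftDerivation_iterate_X, RingHom.coe_coe, scaleVariables_X]
  rw [← coeff_taylorSeries, taylorSeries_prod, ← Finset.prod_congr rfl fun i _ => hmap i,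
    ← map_prod, PowerSeries.coeff_map, RingHom.coe_coe]

lemma map_scaleVariables_jetIdeal (N : ℕ) :
    (jetIdeal K ι (N + 1)).map (scaleVariables K ι (fun j => (j.factorial : K)⁻¹)) =
      Ideal.span {q | ∃ k ≤ N, q = (⇑(shiftDerivation K ι))^[k] (∏ i, X (i, 0))} := by
  have hfac (k : ℕ) : (k.factorial : K) ≠ 0 := Nat.cast_ne_zero.2 k.factorial_ne_zero
  rw [jetIdeal, Ideal.map_span]
  refine le_antisymm (Ideal.span_le.2 ?_) (Ideal.span_le.2 ?_)
  · rintro _ ⟨_, ⟨k, hk, rfl⟩, rfl⟩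
    rw [scaleVariables_coeff_prod_genericSeries, smul_eq_C_mul]
    exact Ideal.mul_mem_left _ _ (Ideal.subset_span ⟨k, Nat.lt_succ_iff.1 hk, rfl⟩)
  · rintro _ ⟨k, hk, rfl⟩
    have := scaleVariables_coeff_prod_genericSeries (K := K) (ι := ι) k
    rw [← inv_smul_eq_iff₀ (inv_ne_zero (hfac k)), smul_eq_C_mul] at this
    rw [← this]
    exact Ideal.mul_mem_left _ _ (Ideal.subset_span ⟨_, ⟨k, Nat.lt_succ_iff.2 hk, rfl⟩, rfl⟩)

theorem prod_X_pow_mem_span_iterate_shiftDerivation_iff (h : ι → ℕ) (d N : ℕ) :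
    (∏ i, (X (i, h i) : MvPolynomial (ι × ℕ) K)) ^ d ∈
        Ideal.span {q | ∃ k ≤ N, q = (⇑(shiftDerivation K ι))^[k] (∏ i, X (i, 0))} ↔
      (∏ i, (X (i, h i) : MvPolynomial (ι × ℕ) K)) ^ d ∈ jetIdeal K ι (N + 1) := by
  have hfac (k : ℕ) : (k.factorial : K) ≠ 0 := Nat.cast_ne_zero.2 k.factorial_ne_zero
  have hscale (c : ℕ → K) (hc : ∀ j, c j ≠ 0) (I : Ideal (MvPolynomial (ι × ℕ) K)) :
      scaleVariables K ι c ((∏ i, X (i, h i)) ^ d) ∈ I ↔ (∏ i, X (i, h i)) ^ d ∈ I := by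
    rw [scaleVariables_prod_X_pow]
    refine Ideal.unit_mul_mem_iff_mem I ?_
    exact (isUnit_iff_ne_zero.2 (pow_ne_zero _ (Finset.prod_ne_zero_iff.2 fun i _ => hc _))).map C
  rw [← map_scaleVariables_jetIdeal]
  constructor
  · intro hf
    have := Ideal.mem_map_of_mem (scaleVariables K ι fun j => (j.factorial : K)) hf
    rw [Ideal.map_mapₐ, scaleVariables_comp fun j => mul_inv_cancel₀ (hfac j),
      hscale _ fun j => hfac j] at this
    rwa [← Ideal.map_id (jetIdeal K ι (N + 1))]
  · intro hf
    rw [← hscale _ fun j => inv_ne_zero (hfac j)]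
    exact Ideal.mem_map_of_mem _ hf

end DifferentialIdeal

/-- In `K{y_1,…,y_n} = K[y_i^{(j)}]` (variables indexed by
`Fin n × ℕ`) with the derivation `D` determined by `D(y_i^{(j)}) = y_i^{(j+1)}`, and
`I_H` the ideal generated by `D^k(y_1⋯y_n)` for `0 ≤ k ≤ H` where `H = h_1 + ⋯ + h_n`:
for `D₀ = max_i (h_i+1)(H-h_i)` one has `(y_1^{(h_1)} ⋯ y_n^{(h_n)})^{D₀} ∉ I_H`, and
consequently the minimal `d` with `(y_1^{(h_1)} ⋯ y_n^{(h_n)})^d ∈ I_H` is `D₀ + 1`. -/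
theorem monomial_pow_minimal_degree
    (K : Type*) [Field K] [CharZero K] (n : ℕ) (hn : 0 < n) (h : Fin n → ℕ)
    (D : Derivation K (MvPolynomial (Fin n × ℕ) K) (MvPolynomial (Fin n × ℕ) K))
    (hD : D = MvPolynomial.mkDerivation K (fun p : Fin n × ℕ => X (p.1, p.2 + 1)))
    (D₀ : ℕ) (hD₀ : D₀ = Finset.univ.sup fun i => (h i + 1) * (∑ j, h j - h i)) :
    (∏ i, (X (i, h i) : MvPolynomial (Fin n × ℕ) K)) ^ D₀ ∉
      Ideal.span {q : MvPolynomial (Fin n × ℕ) K |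
        ∃ k ≤ ∑ i, h i, q = (⇑D)^[k] (∏ i, X (i, 0))} ∧
    IsLeast {d : ℕ | (∏ i, (X (i, h i) : MvPolynomial (Fin n × ℕ) K)) ^ d ∈
      Ideal.span {q : MvPolynomial (Fin n × ℕ) K |
        ∃ k ≤ ∑ i, h i, q = (⇑D)^[k] (∏ i, X (i, 0))}} (D₀ + 1) := by
  subst hD
  obtain ⟨i₀, -, hi₀⟩ := Finset.exists_mem_eq_sup Finset.univ
    (Finset.univ_nonempty_iff.2 ⟨⟨0, hn⟩⟩) fun i => (h i + 1) * (∑ j, h j - h i)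
  have hnot : (∏ i, (X (i, h i) : MvPolynomial (Fin n × ℕ) K)) ^ D₀ ∉
      jetIdeal K (Fin n) (∑ i, h i + 1) := by
    rw [hD₀, hi₀]
    exact prod_X_pow_notMem_jetIdeal h i₀
  have hiff (d : ℕ) := prod_X_pow_mem_span_iterate_shiftDerivation_iff (K := K) h d (∑ i, h i)
  refine ⟨fun hmem => hnot ((hiff D₀).1 hmem), (hiff _).2 ?_, fun d hd => ?_⟩
  · refine prod_X_pow_mem_jetIdeal h fun i => Nat.lt_succ_of_le ?_
    rw [hD₀]
    exact Finset.le_sup (f := fun i => (h i + 1) * (∑ j, h j - h i)) (Finset.mem_univ i)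
  · by_contra! hlt
    exact hnot (Ideal.mem_of_dvd _ (pow_dvd_pow _ (Nat.lt_succ_iff.1 hlt)) ((hiff d).1 hd))
end

section
/- Let n be a positive integer and h_1,…,h_n ∈ ℤ_{≥0} with H = h_1+⋯+h_n. Then for any ideals I_1,…,I_n (not necessarily differential) of A, the inclusion (I_1^{(h_1)} ∩ I_2^{(h_2)} ∩ ⋯ ∩ I_n^{(h_n)})^{n·max_{1≤i≤n}(h_i+1)(H−h_i) + n} ⊆ (I_1 ∩ I_2 ∩ ⋯ ∩ I_n)^{(H)} holds. -/
section PowerSeriesCoefficients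

open PowerSeries

/-- The Taylor expansion `a ↦ ∑ δᵏ(a) Xᵏ / k!` along a derivation, as a ring homomorphism. -/
noncomputable def Derivation.taylor {K A : Type*} [Field K] [CharZero K] [CommRing A] [Algebra K A]
    (δ : Derivation K A A) : A →+* A⟦X⟧ where
  toFun a := PowerSeries.mk fun k => ((k.factorial : K)⁻¹) • (⇑δ)^[k] a
  map_zero' := by
    ext k
    simp [iterate_map_zero]
  map_add' a b := by
    ext k
    simp [iterate_map_add]
  map_one' := by
    ext k
    cases k with
    | zero => simp
    | succ k => simp [Function.iterate_succ_apply, iterate_map_zero, PowerSeries.coeff_one]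
  map_mul' a b := by
    have key (c : A) : PowerSeries.derivative A
          (PowerSeries.mk fun k => ((k.factorial : K)⁻¹) • (⇑δ)^[k] c) =
        PowerSeries.mk fun k => ((k.factorial : K)⁻¹) • (⇑δ)^[k] (δ c) := by
      ext k
      have hk : ((k : K) + 1) ≠ 0 := by exact_mod_cast k.succ_ne_zero
      have : ((k : A) + 1) = algebraMap K A (k + 1) := by simp
      rw [PowerSeries.coeff_derivative, coeff_mk, coeff_mk, mul_comm, this, ← Algebra.smul_def,
        smul_smul, Function.iterate_succ_apply, Nat.factorial_succ]
      congr 1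
      push_cast
      field_simp
    ext k
    induction k generalizing a b with
    | zero => simp
    | succ k ih =>
      have hk : IsUnit ((k : A) + 1) := by
        have : ((k : A) + 1) = algebraMap K A (k + 1) := by simp
        rw [this]
        exact (IsUnit.mk0 _ (by exact_mod_cast k.succ_ne_zero)).map _
      refine hk.mul_right_cancel ?_
      rw [← PowerSeries.coeff_derivative, ← PowerSeries.coeff_derivative, Derivation.leibniz,
        key, key, key, Derivation.leibniz]
      simp only [smul_eq_mul]
      have := ih a (δ b)
      have h2 := ih b (δ a)
      rw [map_add, ← this, ← h2]
      simp [iterate_map_add]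

lemma pow_le_span_pow (K : Type*) {A : Type*} [Field K] [CharZero K] [CommRing A] [Algebra K A]
    (U : Ideal A) (e : ℕ) : U ^ e ≤ Ideal.span {y | ∃ u ∈ U, y = u ^ e} := by
  set N := Ideal.span {y | ∃ u ∈ U, y = u ^ e} with hN
  suffices H : ∀ (k : ℕ) (w : A), (∀ u ∈ U, u ^ k * w ∈ N) → ∀ y ∈ U ^ k, y * w ∈ N by
    intro y hy
    have hpow : ∀ u ∈ U, u ^ e * 1 ∈ N := fun u hu => by
      rw [mul_one]
      exact Ideal.subset_span ⟨u, hu, rfl⟩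
    simpa using H e 1 hpow y hy
  intro k
  induction k with
  | zero =>
    intro w hw y _
    exact N.mul_mem_left y (by simpa using hw 0 U.zero_mem)
  | succ k ih =>
    intro w hw y hy
    have step : ∀ u ∈ U, ∀ v ∈ U, u ^ k * (v * w) ∈ N := by
      intro u hu v hv
      rw [← Ideal.Quotient.eq_zero_iff_mem, ← Module.forall_dual_apply_eq_zero_iff K]
      intro φ
      let c : ℕ → K := fun m =>
        φ (Ideal.Quotient.mk N (u ^ (k + 1 - m) * v ^ m * ((k + 1).choose m : A) * w))
      have hp : (∑ m ∈ Finset.range (k + 2), Polynomial.monomial m (c m) : Polynomial K) = 0 := by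
        refine Polynomial.funext fun r => ?_
        have h0 := hw (algebraMap K A r * v + u) (U.add_mem (U.mul_mem_left _ hv) hu)
        rw [← Ideal.Quotient.eq_zero_iff_mem] at h0
        have h1 := congrArg φ h0
        rw [add_pow, Finset.sum_mul, map_sum, map_sum, map_zero] at h1
        rw [Polynomial.eval_zero, Polynomial.eval_finsetSum, ← h1]
        refine Finset.sum_congr rfl fun m _ => ?_
        rw [Polynomial.eval_monomial, mul_comm, ← smul_eq_mul, ← map_smul]
        congr 1
        rw [Algebra.smul_def, ← Ideal.Quotient.mk_algebraMap, ← map_mul]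
        congr 1
        rw [map_pow]
        ring
      have h1 := congrArg (Polynomial.coeff · 1) hp
      simp only [Polynomial.finsetSum_coeff, Polynomial.coeff_monomial, Polynomial.coeff_zero] at h1
      rw [Finset.sum_ite_eq' , if_pos (by simp)] at h1
      have h2 : c 1 = (k + 1 : K) • φ (Ideal.Quotient.mk N (u ^ k * (v * w))) := by
        rw [← map_smul]
        simp only [c]
        congr 1
        rw [Algebra.smul_def, ← Ideal.Quotient.mk_algebraMap, ← map_mul]
        congr 1
        simp
        ring
      rw [h2] at h1
      exact (smul_eq_zero.mp h1).resolve_left (by exact_mod_cast k.succ_ne_zero)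
    rw [pow_succ] at hy
    induction hy using Submodule.mul_induction_on' with
    | mem_mul_mem a ha b hb =>
      rw [mul_assoc]
      exact ih (b * w) (fun u hu => step u hu b hb) a ha
    | add a _ b _ ha hb =>
      rw [add_mul]
      exact N.add_mem ha hb

lemma sum_sq_lt_of_perm {m : ℕ} (b c : Fin m → ℕ) (hb : Monotone b) (σ : Equiv.Perm (Fin m))
    (hσ : σ ≠ 1) (hc : ∀ i, c i + σ i = b i + i) : ∑ i, b i ^ 2 < ∑ i, c i ^ 2 := by
  have h1 : ∑ i, (b i : ℤ) * ((σ i : ℕ) : ℤ) ≤ ∑ i, (b i : ℤ) * ((i : ℕ) : ℤ) := by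
    have : Monovary (fun i => (b i : ℤ)) (fun i : Fin m => ((i : ℕ) : ℤ)) := by
      intro i j hij
      have : (i : ℕ) ≤ j := by
        have : ((i : ℕ) : ℤ) < (j : ℕ) := hij
        omega
      have h := hb (show i ≤ j from this)
      show (b i : ℤ) ≤ b j
      exact_mod_cast h
    exact this.sum_mul_comp_perm_le_sum_mul (σ := σ)
  obtain ⟨k, hk⟩ : ∃ k, σ k ≠ k := by
    by_contra! h
    exact hσ (Equiv.ext h)
  have h2 : 0 < ∑ i : Fin m, (((i : ℕ) : ℤ) - ((σ i : ℕ) : ℤ)) ^ 2 := by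
    refine Finset.sum_pos' (fun i _ => sq_nonneg _) ⟨k, Finset.mem_univ _, ?_⟩
    have : ((k : ℕ) : ℤ) - ((σ k : ℕ) : ℤ) ≠ 0 := by
      intro h
      exact hk (Fin.ext (by omega))
    positivity
  have h3 : ∑ i, (c i : ℤ) ^ 2 = ∑ i, (b i : ℤ) ^ 2 +
      2 * (∑ i, (b i : ℤ) * ((i : ℕ) : ℤ) - ∑ i, (b i : ℤ) * ((σ i : ℕ) : ℤ)) +
      ∑ i : Fin m, (((i : ℕ) : ℤ) - ((σ i : ℕ) : ℤ)) ^ 2 := by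
    rw [← Finset.sum_sub_distrib, Finset.mul_sum, ← Finset.sum_add_distrib,
      ← Finset.sum_add_distrib]
    refine Finset.sum_congr rfl fun i _ => ?_
    have : (c i : ℤ) = b i + (i : ℕ) - (σ i : ℕ) := by
      have := hc i
      omega
    rw [this]
    ring
  zify
  linarith

lemma sum_sq_le_sq_sum (s : Multiset ℕ) : (s.map (· ^ 2)).sum ≤ s.sum ^ 2 := by
  induction s using Multiset.induction with
  | empty => simp
  | cons a s ih =>
    simp only [Multiset.map_cons, Multiset.sum_cons]
    nlinarith [Nat.zero_le (a * s.sum)]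

/-- Straightening modulo Toeplitz minors. -/
lemma prod_mem_of_toeplitz_minors_mem {R : Type*} [CommRing R] (x : ℕ → R) (l h : ℕ) (M : Ideal R)
    (hM : ∀ a : Fin (l + 1) → ℕ, (∀ i, a i ≤ h + l) →
      (Matrix.of fun i j : Fin (l + 1) => if (j : ℕ) ≤ a i then x (a i - j) else 0).det ∈ M)
    (s : Multiset ℕ) (hs : s.sum < (s.card - l) * (h + 1)) : (s.map x).prod ∈ M := by
  induction hN : s.sum ^ 2 - (s.map (· ^ 2)).sum using Nat.strong_induction_on generalizing s with
  | _ N ih =>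
  subst hN
  have hcard : l + 1 ≤ (s.filter (· ≤ h)).card := by
    by_contra! hlt
    have h1 := Multiset.filter_add_not (· ≤ h) s
    have h2 : (s.filter (fun a => ¬ a ≤ h)).card • (h + 1) ≤ (s.filter (fun a => ¬ a ≤ h)).sum := by
      refine Multiset.card_nsmul_le_sum fun a ha => ?_
      have := (Multiset.mem_filter.mp ha).2
      omega
    have h3 := congrArg Multiset.card h1
    have h4 := congrArg Multiset.sum h1
    rw [Multiset.card_add] at h3
    rw [Multiset.sum_add] at h4
    have h5 : (s.card - l) * (h + 1) ≤ (s.filter (fun a => ¬ a ≤ h)).card * (h + 1) :=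
      Nat.mul_le_mul_right _ (by omega)
    rw [smul_eq_mul] at h2
    omega
  obtain ⟨u, hu, hul⟩ : ∃ u ≤ s.filter (· ≤ h), u.card = l + 1 := by
    obtain ⟨u, hu⟩ := Multiset.card_pos_iff_exists_mem.mp
      ((Multiset.card_powersetCard (l + 1) (s.filter (· ≤ h))).symm ▸ Nat.choose_pos hcard)
    exact ⟨u, Multiset.mem_powersetCard.mp hu⟩
  obtain ⟨t, ht⟩ := Multiset.le_iff_exists_add.mp (hu.trans (Multiset.filter_le _ _))
  obtain ⟨b, hbm, hbu⟩ : ∃ b : Fin (l + 1) → ℕ, Monotone b ∧ Finset.univ.val.map b = u := by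
    have hlen : (u.sort (· ≤ ·)).length = l + 1 := by simp [hul]
    refine ⟨fun i => (u.sort (· ≤ ·)).get (i.cast hlen.symm), ?_, ?_⟩
    · intro i j hij
      exact (Multiset.pairwise_sort u (· ≤ ·)).sortedLE.monotone_get (by simpa using hij)
    · rw [Fin.univ_val_map]
      conv_rhs => rw [← Multiset.sort_eq u (· ≤ ·)]
      congr 1
      refine List.ext_get (by simp [hul]) fun n h1 h2 => by rw [List.get_ofFn]; rfl
  have hbh (i) : b i ≤ h := by
    have : b i ∈ u := by
      rw [← hbu]
      exact Multiset.mem_map_of_mem _ (Finset.mem_univ_val i)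
    exact (Multiset.mem_filter.mp (Multiset.mem_of_le hu this)).2
  have hdet := hM (fun i => b i + i) (fun i => by have := hbh i; have := i.2; omega)
  rw [← Matrix.det_transpose, Matrix.det_apply, ← Finset.add_sum_erase _ _ (Finset.mem_univ 1)] at hdet
  have hid : (s.map x).prod = (t.map x).prod * ∏ i, x (b i) := by
    rw [ht, Multiset.map_add, Multiset.prod_add, ← hbu, Multiset.map_map, mul_comm]
    rfl
  have hrest : ∀ σ ∈ (Finset.univ : Finset (Equiv.Perm (Fin (l + 1)))).erase 1,
      (t.map x).prod * ∏ i, (if ((σ i : Fin (l+1)) : ℕ) ≤ b i + i then x (b i + i - σ i) else 0) ∈ M := by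
    intro σ hσ
    by_cases hneg : ∃ i, ¬ ((σ i : ℕ) ≤ b i + i)
    · obtain ⟨i, hi⟩ := hneg
      rw [Finset.prod_eq_zero (Finset.mem_univ i) (if_neg hi), mul_zero]
      exact M.zero_mem
    push Not at hneg
    set c : Fin (l + 1) → ℕ := fun i => b i + i - σ i with hc
    have hc' (i) : c i + σ i = b i + i := Nat.sub_add_cancel (hneg i)
    have hsq := sum_sq_lt_of_perm b c hbm σ (Finset.ne_of_mem_erase hσ) hc'
    have hsum : ∑ i, c i = ∑ i, b i := by
      have h1 : ∑ i, (c i + (σ i : ℕ)) = ∑ i, (b i + (i : ℕ)) :=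
        Finset.sum_congr rfl fun i _ => hc' i
      rw [Finset.sum_add_distrib, Finset.sum_add_distrib,
        Equiv.sum_comp σ (fun i : Fin (l + 1) => (i : ℕ))] at h1
      omega
    have e1 : (t + Finset.univ.val.map c).sum = s.sum := by
      rw [ht, Multiset.sum_add, Multiset.sum_add, ← hbu, add_comm]
      congr 1
    have e2 : (t + Finset.univ.val.map c).card = s.card := by
      rw [ht, Multiset.card_add, Multiset.card_add, ← hbu, Multiset.card_map, Multiset.card_map,
        add_comm]
    have e3 : (s.map (· ^ 2)).sum < ((t + Finset.univ.val.map c).map (· ^ 2)).sum := by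
      rw [ht, Multiset.map_add, Multiset.map_add, Multiset.sum_add, Multiset.sum_add, ← hbu, add_comm,
        Multiset.map_map, Multiset.map_map]
      exact Nat.add_lt_add_left hsq _
    have e4 := sum_sq_le_sq_sum (t + Finset.univ.val.map c)
    have := ih _ (by rw [e1] at e4 ⊢; omega) (t + Finset.univ.val.map c) (by rw [e1, e2]; exact hs) rfl
    rw [Multiset.map_add, Multiset.prod_add, Multiset.map_map] at this
    convert this using 2
    refine Finset.prod_congr rfl fun i _ => ?_
    rw [if_pos (hneg i)]
    rfl
  have h1 := M.mul_mem_left (t.map x).prod hdet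
  rw [mul_add, Finset.mul_sum] at h1
  have h2 := (Submodule.add_mem_iff_left M (Submodule.sum_mem M fun σ hσ => ?_)).mp h1
  · rw [hid]
    simpa using h2
  · rw [mul_smul_comm]
    have := hrest σ hσ
    simp only [Matrix.transpose_apply, Matrix.of_apply]
    rw [Units.smul_def, zsmul_eq_mul]
    exact M.mul_mem_left _ this

lemma det_mul_eq_zero_of_card_lt {m ι R : Type*} [CommRing R] [Fintype m] [DecidableEq m]
    [Fintype ι] (P : Matrix m ι R) (Q : Matrix ι m R) (hc : Fintype.card ι < Fintype.card m) :
    (P * Q).det = 0 := by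
  classical
  obtain ⟨f⟩ : Nonempty (ι ↪ m) := Function.Embedding.nonempty_of_card_le hc.le
  obtain ⟨r, hr⟩ : ∃ r, ∀ i, f i ≠ r := by
    by_contra! h
    exact hc.not_ge (Fintype.card_le_of_surjective f h)
  let P' : Matrix m m R := Matrix.of fun a b => ∑ i, if f i = b then P a i else 0
  let Q' : Matrix m m R := Matrix.of fun b c => ∑ i, if f i = b then Q i c else 0
  have : P * Q = P' * Q' := by
    ext a c
    simp only [Matrix.mul_apply, Matrix.of_apply, P', Q', Finset.sum_mul, ite_mul, zero_mul]
    rw [Finset.sum_comm]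
    refine Finset.sum_congr rfl fun i _ => ?_
    simp [f.injective.eq_iff]
  rw [this, Matrix.det_mul, Matrix.det_eq_zero_of_row_eq_zero (A := Q') r fun j => ?_, mul_zero]
  exact Finset.sum_eq_zero fun i _ => if_neg (hr i)

lemma sum_fin_coeff_mul {R : Type*} [CommRing R] (C F : R⟦X⟧) {d k : ℕ} (hk : k < d) :
    ∑ k' : Fin d, (if (k' : ℕ) ≤ k then coeff (k - k') C else 0) * coeff k' F =
      coeff k (C * F) := by
  rw [mul_comm C F, coeff_mul, Finset.Nat.sum_antidiagonal_eq_sum_range_succ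
    (fun i j => coeff i F * coeff j C),
    Fin.sum_univ_eq_sum_range (fun k' => (if k' ≤ k then coeff (k - k') C else 0) * coeff k' F)]
  refine (Finset.sum_subset_zero_on_sdiff ?_ ?_ ?_).symm
  · intro i hi
    simp only [Finset.mem_range] at hi ⊢
    omega
  · intro i hi
    simp only [Finset.mem_sdiff, Finset.mem_range] at hi
    rw [if_neg (by omega), zero_mul]
  · intro i hi
    simp only [Finset.mem_range] at hi
    rw [if_pos (by omega), mul_comm]

/-- If the last of `n + 1` families of power series is, up to order `d`, a combination of
the others, then matrices of more than `n * d` rows of their coefficients are singular. -/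
lemma det_coeff_eq_zero {R κ : Type*} [CommRing R] [Fintype κ] [DecidableEq κ] {n d : ℕ}
    (φ : Fin (n + 1) → κ → R⟦X⟧) (C : Fin n → R⟦X⟧)
    (hC : ∀ k < d, ∀ c, coeff k (φ (Fin.last n) c) = coeff k (∑ i, C i * φ i.castSucc c))
    (F : κ → Fin (n + 1) × Fin d) (hκ : n * d < Fintype.card κ) :
    (Matrix.of fun r c => coeff ((F r).2 : ℕ) (φ (F r).1 c)).det = 0 := by
  let P : Matrix κ (Fin n × Fin d) R := Matrix.of fun r ik =>
    Fin.lastCases (motive := fun _ => R)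
      (if (ik.2 : ℕ) ≤ (F r).2 then coeff ((F r).2 - ik.2 : ℕ) (C ik.1) else 0)
      (fun i => if ik = (i, (F r).2) then 1 else 0) (F r).1
  let Q : Matrix (Fin n × Fin d) κ R := Matrix.of fun ik c => coeff (ik.2 : ℕ) (φ ik.1.castSucc c)
  have : (Matrix.of fun r c => coeff ((F r).2 : ℕ) (φ (F r).1 c)) = P * Q := by
    ext r c
    simp only [Matrix.of_apply, Matrix.mul_apply, P, Q]
    generalize F r = ik
    obtain ⟨i, k⟩ := ik
    refine Fin.lastCases ?_ (fun i => ?_) i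
    · simp only [Fin.lastCases_last]
      rw [hC _ k.2, map_sum, Fintype.sum_prod_type]
      exact Finset.sum_congr rfl fun i _ => (sum_fin_coeff_mul _ _ k.2).symm
    · simp
  rw [this]
  exact det_mul_eq_zero_of_card_lt P Q (by simpa using hκ)

lemma prod_minors_eq_zero {R : Type*} [CommRing R] {n d : ℕ} (x : Fin (n + 1) → R⟦X⟧)
    (hx : ∀ k < d, coeff k (∏ i, x i) = 0) (r : Fin (n + 1) → ℕ) (hr : n * d < ∑ i, r i)
    (f : ∀ i, Fin (r i) → Fin d) :
    ∏ i, (Matrix.of fun a b : Fin (r i) => coeff (f i a : ℕ) (X ^ (b : ℕ) * x i)).det = 0 := by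
  let φ : Fin (n + 1) → (Σ i, Fin (r i)) → R⟦X⟧ := fun i c =>
    if c.1 = i then X ^ (c.2 : ℕ) * x i
    else if (c.1 : ℕ) = i + 1 then -X ^ (c.2 : ℕ) else 0
  have h0 := det_coeff_eq_zero (d := d) φ (fun i => -∏ j ∈ Finset.Ioi i.castSucc, x j) ?_
    (fun c => (c.1, f c.1 c.2)) (by simpa using hr)
  · rw [Matrix.BlockTriangular.det_fintype (b := Sigma.fst)] at h0
    · rw [← h0]
      refine Finset.prod_congr rfl fun k _ => ?_
      rw [← Matrix.det_reindex_self (Equiv.sigmaSubtype k)]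
      congr 1
      ext a b
      simp [Matrix.toSquareBlock_def, φ, Equiv.sigmaSubtype]
    · intro i j hij
      have : (j.1 : ℕ) < i.1 := hij
      simp only [Matrix.of_apply, φ]
      rw [if_neg (by rintro h; omega), if_neg (by omega), map_zero]
  · rintro k hk ⟨j, b⟩
    have hD : coeff k (∑ i, (∏ j ∈ Finset.Ioi i, x j) * φ i ⟨j, b⟩) = 0 := by
      refine Fin.cases (fun b => ?_) (fun j b => ?_) j b
      · rw [Finset.sum_eq_single 0]
        · have : (∏ j ∈ Finset.Ioi 0, x j) * φ 0 ⟨0, b⟩ = X ^ (b : ℕ) * ∏ i, x i := by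
            simp only [φ, if_true]
            rw [Fin.prod_Ioi_zero, Fin.prod_univ_succ]
            ring
          rw [this, coeff_X_pow_mul']
          split_ifs
          · exact hx _ (by omega)
          · rfl
        · intro i _ hi
          simp [φ, hi.symm]
        · simp
      · rw [Finset.sum_eq_add j.succ j.castSucc (by simp [Fin.ext_iff])]
        · have : Finset.Ioi j.castSucc = insert j.succ (Finset.Ioi j.succ) := by
            ext i
            simp only [Finset.mem_Ioi, Finset.mem_insert, Fin.lt_def, Fin.ext_iff, Fin.val_succ,
              Fin.val_castSucc]
            omega
          rw [this, Finset.prod_insert (by simp)]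
          simp only [φ, if_true, Fin.val_succ, Fin.val_castSucc]
          rw [if_neg (by simp [Fin.ext_iff])]
          convert map_zero (coeff (R := R) k) using 2
          ring
        · rintro i - ⟨h1, h2⟩
          simp only [φ]
          rw [if_neg (Ne.symm h1), if_neg, mul_zero]
          intro h
          apply h2
          ext
          simpa using h.symm
        · simp
        · simp
    rw [Fin.sum_univ_castSucc] at hD
    have hlast : Finset.Ioi (Fin.last n) = ∅ := by
      ext i
      simpa using Fin.le_last i
    rw [hlast, Finset.prod_empty, one_mul, map_add] at hD
    rw [eq_neg_of_add_eq_zero_right hD, ← map_neg]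
    simp [Finset.sum_neg_distrib]

lemma prod_coeff_pow_eq_zero {R : Type*} [CommRing R] {n : ℕ} (hn : 0 < n) (h : Fin n → ℕ)
    (x : Fin n → R⟦X⟧) (hx : ∀ k ≤ ∑ i, h i, coeff k (∏ i, x i) = 0) :
    ∏ i, coeff (h i) (x i) ^ ((h i + 1) * (∑ j, h j - h i) + 1) = 0 := by
  obtain ⟨n, rfl⟩ := Nat.exists_eq_add_one.mpr hn
  set H := ∑ j, h j with hH
  have hle (i) : h i ≤ H := Finset.single_le_sum (fun _ _ => Nat.zero_le _) (Finset.mem_univ i)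
  let S : Fin (n + 1) → Set R := fun i => Set.range fun f : Fin (H - h i + 1) → Fin (H + 1) =>
    (Matrix.of fun a b : Fin (H - h i + 1) => coeff (f a : ℕ) (X ^ (b : ℕ) * x i)).det
  have hmem (i) : coeff (h i) (x i) ^ ((h i + 1) * (H - h i) + 1) ∈ Ideal.span (S i) := by
    have := prod_mem_of_toeplitz_minors_mem (fun k => coeff k (x i)) (H - h i) (h i)
      (Ideal.span (S i)) ?_ (Multiset.replicate ((h i + 1) * (H - h i) + 1) (h i)) ?_
    · rwa [Multiset.map_replicate, Multiset.prod_replicate] at this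
    · intro a ha
      refine Ideal.subset_span ⟨fun k => ⟨a k, ?_⟩, ?_⟩
      · have := ha k
        have := hle i
        omega
      · simp only [coeff_X_pow_mul']
    · rw [Multiset.sum_replicate, Multiset.card_replicate, smul_eq_mul]
      generalize H - h i = l
      have : (h i + 1) * l + 1 - l = h i * l + 1 := by
        rw [add_mul, one_mul]
        omega
      rw [this]
      nlinarith
  have hprod := Ideal.prod_mem_prod (s := Finset.univ) fun i _ => hmem i
  rw [Ideal.prod_span] at hprod
  refine (Ideal.mem_bot).mp (Ideal.span_le.mpr ?_ hprod)
  intro y hy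
  obtain ⟨g, hg, rfl⟩ := (Set.mem_fintype_prod _ _).mp hy
  choose f hf using hg
  rw [SetLike.mem_coe, Ideal.mem_bot, ← prod_minors_eq_zero x (d := H + 1)
    (fun k hk => hx k (by omega)) (fun i => H - h i + 1) ?_ f]
  · exact Finset.prod_congr rfl fun i _ => (hf i).symm
  · have : ∑ i, (H - h i + 1) + H = (n + 1) * (H + 1) := by
      nth_rewrite 2 [hH]
      rw [← Finset.sum_add_distrib, Finset.sum_congr rfl (g := fun _ => H + 1)]
      · simp
      · intro i _
        have := hle i
        omega
    rw [add_mul, one_mul] at this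
    omega

lemma coeff_mem_of_mem_map_taylor {K A : Type*} [Field K] [CharZero K] [CommRing A] [Algebra K A]
    (δ : Derivation K A A) (I : Ideal A) (H k : ℕ) (hk : k ≤ H) (F : A⟦X⟧)
    (hF : F ∈ I.map δ.taylor) :
    coeff k F ∈ Ideal.span {x | ∃ a ∈ I, ∃ k ≤ H, x = (⇑δ)^[k] a} := by
  induction hF using Submodule.span_induction generalizing k with
  | mem F hF =>
    obtain ⟨a, ha, rfl⟩ := hF
    simp only [Derivation.taylor, RingHom.coe_mk, MonoidHom.coe_mk, OneHom.coe_mk, coeff_mk]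
    rw [Algebra.smul_def]
    exact Ideal.mul_mem_left _ _ (Ideal.subset_span ⟨a, ha, k, hk, rfl⟩)
  | zero => simp
  | add F G _ _ hF hG =>
    rw [map_add]
    exact Ideal.add_mem _ (hF k hk) (hG k hk)
  | smul G F _ hF =>
    rw [smul_eq_mul, coeff_mul]
    refine Ideal.sum_mem _ fun ij hij => Ideal.mul_mem_left _ _ (hF _ ?_)
    have := Finset.HasAntidiagonal.mem_antidiagonal.mp hij
    omega

lemma exists_mem_map_taylor_coeff_eq {K A : Type*} [Field K] [CharZero K] [CommRing A]
    [Algebra K A] (δ : Derivation K A A) (I : Ideal A) (h : ℕ) (u : A)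
    (hu : u ∈ Ideal.span {x | ∃ a ∈ I, ∃ k ≤ h, x = (⇑δ)^[k] a}) :
    ∃ F ∈ I.map δ.taylor, coeff h F = u := by
  induction hu using Submodule.span_induction with
  | mem u hu =>
    obtain ⟨a, ha, k, hk, rfl⟩ := hu
    refine ⟨C (algebraMap K A k.factorial) * X ^ (h - k) * δ.taylor a,
      Ideal.mul_mem_left _ _ (Ideal.mem_map_of_mem _ ha), ?_⟩
    rw [mul_assoc, coeff_C_mul, coeff_X_pow_mul', if_pos (by omega), Nat.sub_sub_self hk]
    simp only [Derivation.taylor, RingHom.coe_mk, MonoidHom.coe_mk, OneHom.coe_mk, coeff_mk]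
    rw [← Algebra.smul_def, smul_smul, mul_inv_cancel₀ (by exact_mod_cast k.factorial_ne_zero),
      one_smul]
  | zero => exact ⟨0, Ideal.zero_mem _, map_zero _⟩
  | add u v _ _ hu hv =>
    obtain ⟨F, hF, rfl⟩ := hu
    obtain ⟨G, hG, rfl⟩ := hv
    exact ⟨F + G, Ideal.add_mem _ hF hG, map_add _ _ _⟩
  | smul r u _ hu =>
    obtain ⟨F, hF, rfl⟩ := hu
    exact ⟨C r * F, Ideal.mul_mem_left _ _ hF, by rw [coeff_C_mul, smul_eq_mul]⟩

end PowerSeriesCoefficients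

/-- Let `K` be a field of characteristic zero, `A` a commutative
`K`-algebra with a `K`-linear derivation `δ`, and for an ideal `I ⊆ A` and `h ∈ ℕ` let
`I^{(h)}` be the ideal generated by `{δ^k(a) : a ∈ I, 0 ≤ k ≤ h}`.  Then for any ideals
`I_1,…,I_n` of `A` and `H = h_1 + ⋯ + h_n`,
`(I_1^{(h_1)} ∩ ⋯ ∩ I_n^{(h_n)})^{n·max_i (h_i+1)(H-h_i) + n} ⊆ (I_1 ∩ ⋯ ∩ I_n)^{(H)}`. -/
theorem intersection_of_differential_ideals
    (K A : Type*) [Field K] [CharZero K] [CommRing A] [Algebra K A]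
    (δ : Derivation K A A) (n : ℕ) (hn : 0 < n) (h : Fin n → ℕ)
    (I : Fin n → Ideal A) :
    (⨅ i, Ideal.span {x | ∃ a ∈ I i, ∃ k ≤ h i, x = (⇑δ)^[k] a}) ^
        (n * (Finset.univ.sup fun i => (h i + 1) * (∑ j, h j - h i)) + n) ≤
      Ideal.span {x | ∃ a ∈ ⨅ i, I i, ∃ k ≤ ∑ j, h j, x = (⇑δ)^[k] a} := by
  set J := Ideal.span {x | ∃ a ∈ ⨅ i, I i, ∃ k ≤ ∑ j, h j, x = (⇑δ)^[k] a} with hJ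
  set U : Fin n → Ideal A := fun i => Ideal.span {x | ∃ a ∈ I i, ∃ k ≤ h i, x = (⇑δ)^[k] a}
  set e : Fin n → ℕ := fun i => (h i + 1) * (∑ j, h j - h i) with he
  have hpow : ∀ u : Fin n → A, (∀ i, u i ∈ U i) → ∏ i, u i ^ (e i + 1) ∈ J := by
    intro u hu
    choose F hF hFu using fun i => exists_mem_map_taylor_coeff_eq δ (I i) (h i) (u i) (hu i)
    have hprod : ∏ i, F i ∈ (⨅ i, I i).map δ.taylor := by
      have h1 := Ideal.prod_mem_prod (s := Finset.univ) fun i _ => hF i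
      have h2 : ∏ i, (I i).map δ.taylor = (∏ i, I i).map δ.taylor :=
        (map_prod (Ideal.mapHom δ.taylor) I Finset.univ).symm
      rw [h2] at h1
      refine Ideal.map_mono ?_ h1
      rw [← Finset.inf_univ_eq_iInf]
      exact Ideal.prod_le_inf
    have h0 := prod_coeff_pow_eq_zero hn h (fun i => (F i).map (Ideal.Quotient.mk J)) ?_
    · rw [← Ideal.Quotient.eq_zero_iff_mem, ← h0, map_prod]
      refine Finset.prod_congr rfl fun i _ => ?_
      rw [PowerSeries.coeff_map, hFu, map_pow]
    · intro k hk
      rw [← map_prod, PowerSeries.coeff_map, Ideal.Quotient.eq_zero_iff_mem]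
      exact coeff_mem_of_mem_map_taylor δ _ _ k hk _ hprod
  have hle : ∏ i, U i ^ (e i + 1) ≤ J := by
    calc ∏ i, U i ^ (e i + 1)
        ≤ ∏ i, Ideal.span {y | ∃ u ∈ U i, y = u ^ (e i + 1)} :=
          Finset.prod_le_prod' fun i _ => pow_le_span_pow K (U i) _
      _ ≤ J := by
          rw [Ideal.prod_span, Ideal.span_le]
          intro y hy
          obtain ⟨g, hg, rfl⟩ := (Set.mem_fintype_prod _ _).mp hy
          choose u hu hgu using hg
          rw [Finset.prod_congr rfl fun i _ => hgu i]
          exact hpow u hu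
  refine le_trans ?_ hle
  have hexp : (⨅ i, U i) ^ (n * (Finset.univ.sup e) + n) =
      ∏ _i : Fin n, (⨅ i, U i) ^ (Finset.univ.sup e + 1) := by
    rw [Finset.prod_const, Finset.card_univ, Fintype.card_fin, ← pow_mul]
    congr 1
    ring
  rw [hexp]
  refine Finset.prod_le_prod' fun i _ => ?_
  exact (Ideal.pow_le_pow_right (Nat.succ_le_succ (Finset.le_sup (Finset.mem_univ i)))).trans
    (Ideal.pow_right_mono (iInf_le U i) _)
end

section
/- Let ℓ ≥ 2. Then (z_1 + z_2)^{2(ℓ−2)} ≡ C_{ℓ−2} · z_3^2 · z_4^2 ⋯ z_ℓ^2 (mod I_S), i.e., (z_1+z_2)^{2(ℓ−2)} − C_{ℓ−2}·z_3^2⋯z_ℓ^2 ∈ I_S, where C_m denotes the m-th Catalan number. -/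
open MvPolynomial

/-- The complete homogeneous symmetric polynomial of degree `n` in two variables. -/
def completeHomog₂ {R : Type*} [CommRing R] (a b : R) : ℕ → R
  | 0 => 1
  | n + 1 => a * completeHomog₂ a b n + b ^ (n + 1)

theorem catalan_add_choose (m : ℕ) :
    catalan m + (2 * m).choose (m + 1) = (2 * m).choose m := by
  have h₁ := succ_mul_catalan_eq_centralBinom m
  have h₂ := Nat.choose_succ_right_eq (2 * m) m
  rw [Nat.centralBinom_eq_two_mul_choose] at h₁
  rw [show 2 * m - m = m by omega] at h₂
  apply Nat.eq_of_mul_eq_mul_left (Nat.succ_pos m)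
  rw [Nat.succ_eq_add_one]
  linarith

section TwoVariables

variable {R : Type*} [CommRing R] (a b : R)

theorem completeHomog₂_succ' (n : ℕ) :
    completeHomog₂ a b (n + 1) = b * completeHomog₂ a b n + a ^ (n + 1) := by
  induction n with
  | zero => simp [completeHomog₂]; ring
  | succ n ih =>
    have h : completeHomog₂ a b (n + 1) = a * completeHomog₂ a b n + b ^ (n + 1) := rfl
    rw [completeHomog₂]
    linear_combination a * ih - b * h

theorem completeHomog₂_succ_succ (n : ℕ) :
    completeHomog₂ a b (n + 2) =
      (a + b) * completeHomog₂ a b (n + 1) - a * b * completeHomog₂ a b n := by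
  rw [completeHomog₂_succ' a b (n + 1), completeHomog₂_succ' a b n]
  ring

theorem completeHomog₂_sq_sub (n : ℕ) :
    completeHomog₂ a b (n + 1) ^ 2 - completeHomog₂ a b n * completeHomog₂ a b (n + 2) =
      (a * b) ^ (n + 1) := by
  induction n with
  | zero => simp [completeHomog₂]; ring
  | succ n ih =>
    rw [completeHomog₂_succ_succ a b (n + 1)]
    have h := completeHomog₂_succ_succ a b n
    linear_combination a * b * ih +
      completeHomog₂ a b (n + 2) * h

theorem mk_completeHomog₂_mul :
    (1 - PowerSeries.C a * PowerSeries.X) * (1 - PowerSeries.C b * PowerSeries.X) *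
      PowerSeries.mk (completeHomog₂ a b) = 1 := by
  have hb : (1 - PowerSeries.C a * PowerSeries.X) * PowerSeries.mk (completeHomog₂ a b) =
      PowerSeries.mk (fun n => b ^ n) := by
    ext n
    cases n <;> simp [sub_mul, mul_assoc, PowerSeries.coeff_succ_X_mul, completeHomog₂]
  rw [mul_right_comm, hb, mul_comm]
  ext n
  cases n <;> simp [sub_mul, mul_assoc, PowerSeries.coeff_succ_X_mul, PowerSeries.coeff_one,
    pow_succ']

theorem pow_mul_completeHomog₂_eq {n j : ℕ} (ha : a ^ (n + 3) = 0) :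
    a ^ n * completeHomog₂ a b (j + 2) =
      a ^ n * b ^ (j + 2) + a ^ (n + 1) * b ^ (j + 1) + a ^ (n + 2) * b ^ j := by
  cases j with
  | zero => simp [completeHomog₂]; ring
  | succ j =>
    simp only [completeHomog₂]
    linear_combination completeHomog₂ a b j * ha

theorem add_pow_two_mul_eq_catalan {m : ℕ} (h₁ : completeHomog₂ a b (m + 1) = 0)
    (h₂ : completeHomog₂ a b (m + 2) = 0) :
    (a + b) ^ (2 * m) = catalan m * completeHomog₂ a b m ^ 2 := by
  cases m with
  | zero => simp [completeHomog₂]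
  | succ n =>
    have ha : a ^ (n + 3) = 0 := by
      have := completeHomog₂_succ' a b (n + 2)
      linear_combination h₂ - b * h₁ - this
    have hb : b ^ (n + 3) = 0 := by
      have : completeHomog₂ a b (n + 3) = a * completeHomog₂ a b (n + 2) + b ^ (n + 3) := rfl
      linear_combination h₂ - a * h₁ - this
    have hsq : completeHomog₂ a b (n + 1) ^ 2 = (a * b) ^ (n + 1) := by
      linear_combination completeHomog₂_sq_sub a b n + completeHomog₂ a b n * h₁
    have hrel : a ^ n * b ^ (n + 2) + a ^ (n + 1) * b ^ (n + 1) + a ^ (n + 2) * b ^ n = 0 := by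
      rw [← pow_mul_completeHomog₂_eq a b ha, h₁, mul_zero]
    have hlow : ∀ i ∈ Finset.range n,
        a ^ i * b ^ (2 * (n + 1) - i) * ((2 * (n + 1)).choose i : R) = 0 := by
      intro i hi
      have hi := Finset.mem_range.mp hi
      rw [pow_eq_zero_of_le (by omega : n + 3 ≤ 2 * (n + 1) - i) hb]
      simp
    have hhigh : ∀ i ∈ Finset.range n,
        a ^ (n + 3 + i) * b ^ (2 * (n + 1) - (n + 3 + i)) *
          ((2 * (n + 1)).choose (n + 3 + i) : R) = 0 := by
      intro i _
      rw [pow_add a, ha]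
      simp
    have hcat : (catalan (n + 1) : R) + ((2 * (n + 1)).choose (n + 2) : R) =
        ((2 * (n + 1)).choose (n + 1) : R) := by
      exact_mod_cast congrArg (Nat.cast (R := R)) (catalan_add_choose (n + 1))
    rw [hsq, add_pow, show 2 * (n + 1) + 1 = n + 3 + n by ring, Finset.sum_range_add,
      Finset.sum_eq_zero hhigh, Finset.sum_range_succ, Finset.sum_range_succ,
      Finset.sum_range_succ, Finset.sum_eq_zero hlow,
      show 2 * (n + 1) - n = n + 2 by omega, show 2 * (n + 1) - (n + 1) = n + 1 by omega,
      show 2 * (n + 1) - (n + 2) = n by omega,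
      ← Nat.choose_symm_of_eq_add (show 2 * (n + 1) = (n + 2) + n by ring), mul_pow]
    linear_combination ((2 * (n + 1)).choose (n + 2) : R) * hrel -
      a ^ (n + 1) * b ^ (n + 1) * hcat

end TwoVariables

theorem add_pow_two_mul_eq_catalan_mul_prod {R : Type*} [CommRing R] {m : ℕ}
    (a b : R) (z : Fin m → R)
    (h : (1 - Polynomial.C a * Polynomial.X) * (1 - Polynomial.C b * Polynomial.X) *
      ∏ i, (1 - Polynomial.C (z i) * Polynomial.X) = 1) :
    (a + b) ^ (2 * m) = catalan m * ∏ i, z i ^ 2 := by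
  set Q : Polynomial R := ∏ i, (1 - Polynomial.C (z i) * Polynomial.X) with hQ
  have hdeg (i : Fin m) : (1 - Polynomial.C (z i) * Polynomial.X).natDegree ≤ 1 := by
    compute_degree
  have hQdeg : Q.natDegree ≤ m := by
    simpa using (Polynomial.natDegree_prod_le _ _).trans
      (Finset.sum_le_sum fun i (_ : i ∈ Finset.univ) => hdeg i)
  have hQtop : Q.coeff m = ∏ i, -z i := by
    have := Polynomial.coeff_prod_of_natDegree_le Finset.univ
      (fun i => 1 - Polynomial.C (z i) * Polynomial.X) 1 fun i _ => hdeg i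
    simpa [Polynomial.coeff_one] using this
  have hser : (Q : PowerSeries R) = PowerSeries.mk (completeHomog₂ a b) := by
    have h' := congrArg (Polynomial.toPowerSeries (R := R)) h
    simp only [Polynomial.coe_mul, Polynomial.coe_sub, Polynomial.coe_one, Polynomial.coe_C,
      Polynomial.coe_X] at h'
    linear_combination PowerSeries.mk (completeHomog₂ a b) * h' -
      (Q : PowerSeries R) * mk_completeHomog₂_mul a b
  have hcoeff (n : ℕ) : completeHomog₂ a b n = Q.coeff n := by
    simpa using (congrArg (PowerSeries.coeff n) hser).symm
  have hzero (n : ℕ) (hn : m < n) : completeHomog₂ a b n = 0 := by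
    rw [hcoeff, Polynomial.coeff_eq_zero_of_natDegree_lt (hQdeg.trans_lt hn)]
  rw [add_pow_two_mul_eq_catalan a b (hzero _ (by omega)) (hzero _ (by omega)), hcoeff, hQtop,
    ← Finset.prod_pow]
  simp

namespace MvPolynomial

variable {σ R : Type*} [Fintype σ] [CommRing R]

theorem isSymmetric_coeff_prod_one_sub_X (n : ℕ) :
    ((∏ i : σ, (1 - Polynomial.C (X i : MvPolynomial σ R) * Polynomial.X)).coeff n).IsSymmetric := by
  intro e
  change (rename e : MvPolynomial σ R →ₐ[R] _).toRingHom _ = _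
  rw [← Polynomial.coeff_map, Polynomial.map_prod]
  congr 1
  simpa using Equiv.prod_comp e
    fun i => 1 - Polynomial.C (X i : MvPolynomial σ R) * Polynomial.X

theorem constantCoeff_coeff_prod_one_sub_X {n : ℕ} (hn : n ≠ 0) :
    constantCoeff
      ((∏ i : σ, (1 - Polynomial.C (X i : MvPolynomial σ R) * Polynomial.X)).coeff n) = 0 := by
  rw [← Polynomial.coeff_map, Polynomial.map_prod]
  simp [Polynomial.coeff_one, hn]

/-- The linear factors `1 - z_i t` multiply to `1` over the coinvariant ring. -/
theorem prod_one_sub_mk_X :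
    ∏ i : σ, (1 - Polynomial.C (Ideal.Quotient.mk
      (Ideal.span {p : MvPolynomial σ R | p.IsSymmetric ∧ constantCoeff p = 0}) (X i)) *
        Polynomial.X) = 1 := by
  set I := Ideal.span {p : MvPolynomial σ R | p.IsSymmetric ∧ constantCoeff p = 0}
  have hmap : ∏ i : σ, (1 - Polynomial.C (Ideal.Quotient.mk I (X i)) * Polynomial.X) =
      (∏ i : σ, (1 - Polynomial.C (X i : MvPolynomial σ R) * Polynomial.X)).map
        (Ideal.Quotient.mk I) := by
    simp [Polynomial.map_prod]
  rw [hmap]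
  ext n
  rw [Polynomial.coeff_map]
  rcases eq_or_ne n 0 with rfl | hn
  · simp [Polynomial.coeff_zero_eq_eval_zero, Polynomial.eval_prod]
  · rw [Polynomial.coeff_one, if_neg hn, Ideal.Quotient.eq_zero_iff_mem]
    exact Ideal.subset_span
      ⟨isSymmetric_coeff_prod_one_sub_X n, constantCoeff_coeff_prod_one_sub_X hn⟩

end MvPolynomial

/-- Let `k` be a field of characteristic zero and `ℓ ≥ 2`.  In
`k[z_1,…,z_ℓ]`, modulo the ideal `I_S` generated by all symmetric polynomials with
zero constant term, one has `(z_1 + z_2)^{2(ℓ-2)} ≡ C_{ℓ-2} · z_3^2 ⋯ z_ℓ^2`, where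
`C_m` is the `m`-th Catalan number. -/
theorem catalan_congruence
    (k : Type*) [Field k] [CharZero k] (ℓ : ℕ) (hℓ : 2 ≤ ℓ) :
    (X (⟨0, by omega⟩ : Fin ℓ) + X ⟨1, by omega⟩) ^ (2 * (ℓ - 2)) -
        (catalan (ℓ - 2) : MvPolynomial (Fin ℓ) k) *
          ∏ i ∈ Finset.univ.filter (fun i : Fin ℓ => 2 ≤ (i : ℕ)), X i ^ 2 ∈
      Ideal.span {p : MvPolynomial (Fin ℓ) k | p.IsSymmetric ∧ constantCoeff p = 0} := by
  obtain ⟨m, rfl⟩ := Nat.exists_eq_add_of_le' hℓ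
  rw [← Ideal.Quotient.eq_zero_iff_mem]
  have h := prod_one_sub_mk_X (σ := Fin (m + 2)) (R := k)
  rw [Fin.prod_univ_succ, Fin.prod_univ_succ, ← mul_assoc] at h
  have key := add_pow_two_mul_eq_catalan_mul_prod _ _ _ h
  have hprod : ∏ i ∈ Finset.univ.filter (fun i : Fin (m + 2) => 2 ≤ (i : ℕ)),
      (X i : MvPolynomial (Fin (m + 2)) k) ^ 2 = ∏ i : Fin m, X i.succ.succ ^ 2 := by
    rw [Finset.prod_filter, Fin.prod_univ_succ, Fin.prod_univ_succ]
    simp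
  rw [hprod, Nat.add_sub_cancel, map_sub, sub_eq_zero]
  simpa [map_prod] using key
end
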